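/- arXiv:math/0610724 — 5 statements merged into one kernel-verified Lean document; each statement's English description precedes it below -/
import Mathlib

section
/- Let F be a finite extension of ℚ_p and let L be a biquadratic extension of F, i.e., L/F is Galois of degree 4 with Gal(L/F) isomorphic to ℤ/2ℤ × ℤ/2ℤ. Let K be an intermediate field with [K : F] = 2. Then every element of F^* is a norm from L to K: for every x ∈ F^* there exists y ∈ L^* with N_{L/K}(y) = x. -/
section Herbrand

variable {G : Type*} [CommGroup G]

/-- If `N` and `D` are endomorphisms of a commutative group with `N ∘ D = 1 = D ∘ N`, both
preserving a subgroup `W` of finite index, then the Herbrand quotient of the induced maps on the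
finite quotient by `W` is trivial. -/
theorem Subgroup.relIndex_comap_eq_relIndex_comap (W : Subgroup G) [W.FiniteIndex]
    (N D : G →* G) (hND : ∀ x, N (D x) = 1) (hDN : ∀ x, D (N x) = 1)
    (hNW : ∀ w ∈ W, N w ∈ W) (hDW : ∀ w ∈ W, D w ∈ W) :
    (N.range ⊔ W).relIndex (W.comap D) = (D.range ⊔ W).relIndex (W.comap N) := by
  have expand : ∀ A B : G →* G, (∀ x, B (A x) = 1) → (∀ w ∈ W, B w ∈ W) →
      (W.comap A).index * (A.range ⊔ W).relIndex (W.comap B) * (W.comap B).index = W.index := by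
    intro A B hBA hBW
    have hle : A.range ⊔ W ≤ W.comap B := by
      refine sup_le ?_ fun w hw => hBW w hw
      rintro _ ⟨x, rfl⟩
      simp [Subgroup.mem_comap, hBA]
    rw [Subgroup.index_comap, ← Subgroup.relIndex_sup_right A.range W,
      Subgroup.relIndex_mul_relIndex _ _ _ le_sup_right hle,
      Subgroup.relIndex_mul_index (le_sup_right.trans hle)]
  have h₁ := expand N D hDN hDW
  have h₂ := expand D N hND hNW
  have hW : W.index ≠ 0 := Subgroup.FiniteIndex.index_ne_zero
  have hN : (W.comap N).index ≠ 0 := fun h => hW (by rw [← h₁, h]; simp)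
  have hD : (W.comap D).index ≠ 0 := fun h => hW (by rw [← h₁, h]; simp)
  have h : (W.comap N).index * (W.comap D).index * (N.range ⊔ W).relIndex (W.comap D) =
      (W.comap N).index * (W.comap D).index * (D.range ⊔ W).relIndex (W.comap N) := by
    rw [mul_right_comm, h₁, mul_comm (W.comap N).index, mul_right_comm, h₂]
  exact Nat.eq_of_mul_eq_mul_left (Nat.pos_of_ne_zero (mul_ne_zero hN hD)) h

/-- Let `σ` be an involution of a commutative group `G` satisfying Hilbert's theorem 90. Suppose
that `V` is a `σ`-stable subgroup whose Tate cohomology vanishes, and that `π` is a fixed element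
generating an infinite cyclic group which meets `V` trivially and such that `V` and `π` generate
a subgroup of finite index. Then the norms have index two in the group of fixed elements. -/
theorem relIndex_range_norm_eq_two (σ : G →* G) (hσ : ∀ x, σ (σ x) = x)
    (h90 : ∀ x, x * σ x = 1 → ∃ y, x = y / σ y)
    (V : Subgroup G) (hV : ∀ v ∈ V, σ v ∈ V)
    (hV₀ : ∀ v ∈ V, σ v = v → ∃ w ∈ V, v = w * σ w)
    (hV₁ : ∀ v ∈ V, v * σ v = 1 → ∃ w ∈ V, v = w / σ w)
    (π : G) (hπ : σ π = π) (hπV : ∀ n : ℤ, π ^ n ∈ V → n = 0)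
    (hfin : (V ⊔ Subgroup.zpowers π).FiniteIndex) :
    (MonoidHom.id G * σ).range.relIndex (MonoidHom.id G / σ).ker = 2 := by
  set N : G →* G := MonoidHom.id G * σ with hNdef
  set D : G →* G := MonoidHom.id G / σ with hDdef
  set W := V ⊔ Subgroup.zpowers π with hWdef
  have hN : ∀ x, N x = x * σ x := fun _ => rfl
  have hD : ∀ x, D x = x / σ x := fun _ => rfl
  have memW : ∀ {x}, x ∈ W ↔ ∃ v ∈ V, ∃ n : ℤ, x = v * π ^ n := by
    intro x
    simp only [hWdef, Subgroup.mem_sup, Subgroup.mem_zpowers_iff]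
    constructor
    · rintro ⟨v, hv, _, ⟨n, rfl⟩, rfl⟩
      exact ⟨v, hv, n, rfl⟩
    · rintro ⟨v, hv, n, rfl⟩
      exact ⟨v, hv, _, ⟨n, rfl⟩, rfl⟩
  have hNπ : ∀ n : ℤ, N (π ^ n) = π ^ (2 * n) := by
    intro n; rw [hN, map_zpow, hπ, ← zpow_add, two_mul]
  have hNV : ∀ v ∈ V, N v ∈ V := fun v hv => V.mul_mem hv (hV v hv)
  have hDV : ∀ v ∈ V, D v ∈ V := fun v hv => V.div_mem hv (hV v hv)
  have hDπ : ∀ n : ℤ, D (π ^ n) = 1 := by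
    intro n; rw [hD, map_zpow, hπ, div_self']
  have hND : ∀ x, N (D x) = 1 := by
    intro x; rw [hN, hD, map_div, hσ]; simp
  have hDN : ∀ x, D (N x) = 1 := by
    intro x; rw [hN, hD, map_mul, hσ, mul_comm (σ x), div_self']
  have hNW : ∀ w ∈ W, N w ∈ W := by
    intro w hw
    obtain ⟨v, hv, n, rfl⟩ := memW.1 hw
    exact memW.2 ⟨N v, hNV v hv, 2 * n, by rw [map_mul, hNπ]⟩
  have hDW : ∀ w ∈ W, D w ∈ W := by
    intro w hw
    obtain ⟨v, hv, n, rfl⟩ := memW.1 hw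
    exact memW.2 ⟨D v, hDV v hv, 0, by rw [map_mul, hDπ]; simp⟩
  have key := Subgroup.relIndex_comap_eq_relIndex_comap W N D hND hDN hNW hDW
  have fixW : ∀ x ∈ W, σ x = x → ∃ v ∈ V, ∃ n : ℤ, x = N v * π ^ n := by
    intro x hx hσx
    obtain ⟨v, hv, n, rfl⟩ := memW.1 hx
    rw [map_mul, map_zpow, hπ, mul_left_inj] at hσx
    obtain ⟨w, hw, rfl⟩ := hV₀ v hv hσx
    exact ⟨w, hw, n, rfl⟩
  have hσN : ∀ x, σ (N x) = N x := by
    intro x; rw [hN, map_mul, hσ, mul_comm]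
  have hNG_le : N.range ≤ D.ker := by
    rintro _ ⟨x, rfl⟩
    exact hDN x
  have hπD : π ∈ D.ker := by
    rw [MonoidHom.mem_ker]; simpa using hDπ 1
  have hleft : (N.range ⊔ W).relIndex (W.comap D) =
      (N.range ⊔ Subgroup.zpowers π).relIndex D.ker := by
    have h₁ : W.comap D = D.ker ⊔ (N.range ⊔ W) := by
      apply le_antisymm
      · intro x hx
        obtain ⟨v, hv, n, hvn⟩ := memW.1 (Subgroup.mem_comap.1 hx)
        have hn : N v * π ^ (2 * n) = 1 := by
          rw [← hNπ, ← map_mul, ← hvn, hND]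
        have hn0 : n = 0 := by
          have := hπV (2 * n) (by
            rw [eq_inv_of_mul_eq_one_right hn]; exact V.inv_mem (hNV v hv))
          lia
        subst hn0
        rw [zpow_zero, mul_one] at hvn
        obtain ⟨w, hw, hvw⟩ := hV₁ v hv (by rw [← hN]; simpa using hn)
        have hxw : x / w ∈ D.ker := by
          rw [MonoidHom.mem_ker, map_div, hvn, hvw, hD, div_self']
        rw [← div_mul_cancel x w]
        exact Subgroup.mul_mem_sup hxw
          (Subgroup.mem_sup_right (Subgroup.mem_sup_left hw))
      · refine sup_le ?_ (sup_le (hNG_le.trans ?_) fun w hw => hDW w hw) <;>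
        · intro x hx
          rw [Subgroup.mem_comap, MonoidHom.mem_ker.1 hx]
          exact W.one_mem
    have h₂ : (N.range ⊔ W) ⊓ D.ker = N.range ⊔ Subgroup.zpowers π := by
      apply le_antisymm
      · rintro x ⟨hx, hxD⟩
        obtain ⟨_, ⟨y, rfl⟩, w, hw, rfl⟩ := Subgroup.mem_sup.1 hx
        have hxD' : σ w = w := by
          have h : D (N y * w) = 1 := hxD
          rw [map_mul, hDN, one_mul, hD, div_eq_one] at h
          exact h.symm
        obtain ⟨v, _, n, rfl⟩ := fixW w hw hxD'
        rw [← mul_assoc, ← map_mul]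
        exact Subgroup.mul_mem_sup ⟨_, rfl⟩ ⟨n, rfl⟩
      · refine le_inf (sup_le_sup_left le_sup_right _) (sup_le hNG_le ?_)
        rwa [Subgroup.zpowers_le]
    rw [h₁, Subgroup.relIndex_sup_right, ← Subgroup.inf_relIndex_right, h₂]
  have hker : ∀ {x}, x ∈ D.range ⊔ W ↔ ∃ w ∈ W, N x = N w := by
    intro x
    constructor
    · intro hx
      obtain ⟨_, ⟨y, rfl⟩, w, hw, rfl⟩ := Subgroup.mem_sup.1 hx
      exact ⟨w, hw, by rw [map_mul, hND, one_mul]⟩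
    · rintro ⟨w, hw, hxw⟩
      obtain ⟨y, hy⟩ := h90 (x / w) (by rw [← hN, map_div, hxw, div_self'])
      rw [← div_mul_cancel x w]
      exact Subgroup.mul_mem_sup ⟨y, hy.symm⟩ hw
  have hπ2 : ∀ n : ℤ, π ^ (2 * n) ∈ N.range := fun n => ⟨_, hNπ n⟩
  by_cases hπN : π ∈ N.range
  · have hleft' : N.range ⊔ Subgroup.zpowers π = N.range := by
      rw [sup_eq_left, Subgroup.zpowers_le]; exact hπN
    rw [hleft, hleft'] at key
    rw [key, Subgroup.relIndex_eq_two_iff_exists_notMem_and]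
    obtain ⟨y, hy⟩ := hπN
    refine ⟨y, ?_, ?_, ?_⟩
    · rw [Subgroup.mem_comap, hy]
      exact memW.2 ⟨1, V.one_mem, 1, by simp⟩
    · rw [hker]
      rintro ⟨w, hw, hyw⟩
      obtain ⟨v, hv, n, rfl⟩ := memW.1 hw
      rw [hy, map_mul, hNπ] at hyw
      have h := hπV (1 - 2 * n) (by
        rw [zpow_sub, zpow_one]
        nth_rewrite 1 [hyw]
        rw [mul_inv_cancel_right]
        exact hNV v hv)
      lia
    · intro b hb
      obtain ⟨v, hv, n, hn⟩ := fixW _ (Subgroup.mem_comap.1 hb) (hσN b)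
      rcases Int.even_or_odd' n with ⟨k, rfl | rfl⟩
      · right
        exact hker.2 ⟨v * π ^ k, memW.2 ⟨v, hv, k, rfl⟩, by rw [hn, map_mul, hNπ]⟩
      · left
        refine hker.2 ⟨v * π ^ (k + 1), memW.2 ⟨v, hv, _, rfl⟩, ?_⟩
        rw [map_mul, map_mul, hNπ, hn, hy, mul_assoc, ← zpow_add_one]
        congr 2; ring
  · have hright : (D.range ⊔ W).relIndex (W.comap N) = 1 := by
      rw [Subgroup.relIndex_eq_one]
      intro b hb
      obtain ⟨v, hv, n, hn⟩ := fixW _ (Subgroup.mem_comap.1 hb) (hσN b)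
      rcases Int.even_or_odd' n with ⟨k, rfl | rfl⟩
      · exact hker.2 ⟨v * π ^ k, memW.2 ⟨v, hv, k, rfl⟩, by rw [hn, map_mul, hNπ]⟩
      · refine absurd ?_ hπN
        rw [zpow_add_one, ← hNπ, ← mul_assoc, ← map_mul] at hn
        rw [← inv_mul_eq_iff_eq_mul.2 hn, ← map_inv, ← map_mul]
        exact ⟨_, rfl⟩
    rw [hleft, hright, Subgroup.relIndex_eq_one] at key
    rw [Subgroup.relIndex_eq_two_iff_exists_notMem_and]
    refine ⟨π, hπD, hπN, fun b hb => ?_⟩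
    obtain ⟨x, hx, _, ⟨n, rfl⟩, rfl⟩ := Subgroup.mem_sup.1 (key hb)
    rcases Int.even_or_odd' n with ⟨k, rfl | rfl⟩
    · exact Or.inr (mul_mem hx (hπ2 k))
    · left
      beta_reduce
      rw [mul_assoc, ← zpow_add_one]
      refine mul_mem hx ?_
      convert hπ2 (k + 1) using 2
      ring

end Herbrand

section Exponential

open NormedSpace Filter Topology
open scoped Nat

variable (p : ℕ) [Fact p.Prime]

theorem Padic.norm_inv_factorial_le (n : ℕ) : ‖((n ! : ℚ_[p]))⁻¹‖ ≤ (p : ℝ) ^ n := by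
  have hp : 1 ≤ (p : ℝ) := by exact_mod_cast (Fact.out : p.Prime).one_lt.le
  rw [norm_inv, Padic.norm_eq_zpow_neg_valuation (by exact_mod_cast n.factorial_ne_zero),
    ← zpow_neg, neg_neg, Padic.valuation_natCast, zpow_natCast]
  refine pow_le_pow_right₀ hp ?_
  have h := sub_one_mul_padicValNat_factorial (p := p) n
  have h2 : 1 ≤ p - 1 := Nat.le_sub_one_of_lt (Fact.out : p.Prime).one_lt
  calc padicValNat p n ! ≤ (p - 1) * padicValNat p n ! := Nat.le_mul_of_pos_left _ h2
    _ ≤ n := h ▸ Nat.sub_le _ _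

theorem Padic.expSeries_radius_pos (E : Type*) [NormedField E] [NormedAlgebra ℚ_[p] E] :
    0 < (expSeries ℚ_[p] E).radius := by
  have hp : 0 < (p : ℝ) := by exact_mod_cast (Fact.out : p.Prime).pos
  let r : NNReal := ⟨(p : ℝ)⁻¹, by positivity⟩
  have hr : (0 : ENNReal) < r := by
    rw [ENNReal.coe_pos]; exact inv_pos.2 hp
  refine hr.trans_le (FormalMultilinearSeries.le_radius_of_bound _ 1 fun n => ?_)
  calc ‖expSeries ℚ_[p] E n‖ * (r : ℝ) ^ n
      ≤ (p : ℝ) ^ n * ((p : ℝ)⁻¹) ^ n := by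
        gcongr
        · rw [expSeries, norm_smul, ContinuousMultilinearMap.norm_mkPiAlgebraFin, mul_one]
          exact Padic.norm_inv_factorial_le p n
        · exact le_rfl
    _ = 1 := by rw [← mul_pow, mul_inv_cancel₀ hp.ne', one_pow]

/-- Near `0` the exponential is an injective homomorphism and commutes with isometric
automorphisms. -/
theorem Padic.exists_ball_exp (E : Type*) [NormedField E] [NormedAlgebra ℚ_[p] E]
    [CompleteSpace E] :
    ∃ r > 0, (∀ x y : E, ‖x‖ < r → ‖y‖ < r → exp (x + y) = exp x * exp y) ∧
      (∀ x y : E, ‖x‖ < r → ‖y‖ < r → exp x = exp y → x = y) ∧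
      (∀ x : E, ‖x‖ < r → ‖exp x - 1‖ < 1) ∧
      (∀ σ : E ≃ₐ[ℚ_[p]] E, (∀ x, ‖σ x‖ = ‖x‖) → ∀ x : E, ‖x‖ < r → σ (exp x) = exp (σ x)) ∧
      (∀ s ∈ 𝓝 (0 : E), exp '' s ∈ 𝓝 (1 : E)) := by
  have hrad := Padic.expSeries_radius_pos p E
  have hder : HasStrictFDerivAt (exp : E → E) ((ContinuousLinearEquiv.refl ℚ_[p] E : E →L[ℚ_[p]] E))
      0 := hasStrictFDerivAt_exp_zero_of_radius_pos hrad
  have hcont : ContinuousAt (exp : E → E) 0 := hder.continuousAt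
  have hball : Metric.eball (0 : E) (expSeries ℚ_[p] E).radius ∈ 𝓝 (0 : E) :=
    Metric.eball_mem_nhds _ hrad
  have hinj : (hder.toOpenPartialHomeomorph exp).source ∈ 𝓝 (0 : E) :=
    (hder.toOpenPartialHomeomorph exp).open_source.mem_nhds
      hder.mem_toOpenPartialHomeomorph_source
  have hone : {x : E | ‖exp x - 1‖ < 1} ∈ 𝓝 (0 : E) := by
    have h : Metric.ball (1 : E) 1 ∈ 𝓝 (exp (0 : E)) := by
      rw [exp_zero]; exact Metric.ball_mem_nhds _ one_pos
    filter_upwards [hcont h] with x hx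
    simpa [dist_eq_norm] using hx
  obtain ⟨r, hr, hsub⟩ := Metric.mem_nhds_iff.1 (inter_mem (inter_mem hball hinj) hone)
  have hmem : ∀ x : E, ‖x‖ < r → x ∈ Metric.ball (0 : E) r := fun x hx => by simpa using hx
  refine ⟨r, hr, fun x y hx hy => ?_, fun x y hx hy h => ?_, fun x hx => ?_, fun σ hσ x hx => ?_,
    fun s hs => ?_⟩
  · exact exp_add_of_mem_ball (𝕂 := ℚ_[p]) (hsub (hmem x hx)).1.1 (hsub (hmem y hy)).1.1
  · exact (hder.toOpenPartialHomeomorph exp).injOn (hsub (hmem x hx)).1.2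
      (hsub (hmem y hy)).1.2 h
  · exact (hsub (hmem x hx)).2
  · have hσc : Continuous σ :=
      (AddMonoidHomClass.isometry_of_norm σ hσ).continuous
    exact map_exp_of_mem_ball (𝕂 := ℚ_[p]) σ hσc x (hsub (hmem x hx)).1.1
  · have h := hder.map_nhds_eq_of_equiv
    rw [exp_zero] at h
    rw [← h]
    exact image_mem_map hs

/-- A subgroup of small units with vanishing Tate cohomology for an isometric involution. -/
theorem Padic.exists_subgroup_cohomologically_trivial (E : Type*) [NormedField E]
    [NormedAlgebra ℚ_[p] E] [CompleteSpace E] [IsUltrametricDist E]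
    (σ : E ≃ₐ[ℚ_[p]] E) (hσ : ∀ x, σ (σ x) = x) (hiso : ∀ x, ‖σ x‖ = ‖x‖)
    (α : E) (hα : σ α = -α) (hα0 : α ≠ 0) :
    ∃ V : Subgroup Eˣ, (∀ v ∈ V, Units.map (σ : E →* E) v ∈ V) ∧
      (∀ v ∈ V, Units.map (σ : E →* E) v = v → ∃ w ∈ V, v = w * Units.map (σ : E →* E) w) ∧
      (∀ v ∈ V, v * Units.map (σ : E →* E) v = 1 → ∃ w ∈ V, v = w / Units.map (σ : E →* E) w) ∧
      (∀ v ∈ V, ‖(v : E)‖ = 1) ∧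
      (∃ ε > 0, ∀ v : Eˣ, ‖(v : E) - 1‖ < ε → v ∈ V) := by
  obtain ⟨r, hr, hadd, hinj, hone, hequiv, hopen⟩ := Padic.exists_ball_exp p E
  have : CharZero E := charZero_of_injective_algebraMap (algebraMap ℚ_[p] E).injective
  obtain ⟨c, hc, hc0⟩ : ∃ c : ℝ, 0 < c ∧ ∀ u : E, ‖u‖ < c → ‖u‖ * max 1 ‖α‖ < r := by
    have hm : 0 < max 1 ‖α‖ := by positivity
    exact ⟨r / max 1 ‖α‖, by positivity, fun u hu => (lt_div_iff₀ hm).1 hu⟩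
  let B : AddSubgroup E :=
    { carrier := {u | σ u = u ∧ ‖u‖ < c}
      zero_mem' := by simp [hc]
      add_mem' := by
        rintro a b ⟨ha, ha'⟩ ⟨hb, hb'⟩
        exact ⟨by rw [map_add, ha, hb],
          (IsUltrametricDist.norm_add_le_max a b).trans_lt (max_lt ha' hb')⟩
      neg_mem' := by
        rintro a ⟨ha, ha'⟩
        exact ⟨by rw [map_neg, ha], by rwa [norm_neg]⟩ }
  -- `1 + α` and its conjugate `1 - α` form a normal basis
  let Λ : AddSubgroup E :=
    { carrier := {x | ∃ u ∈ B, ∃ v ∈ B, x = u * (1 + α) + v * (1 - α)}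
      zero_mem' := ⟨0, B.zero_mem, 0, B.zero_mem, by simp⟩
      add_mem' := by
        rintro _ _ ⟨u, hu, v, hv, rfl⟩ ⟨u', hu', v', hv', rfl⟩
        exact ⟨_, B.add_mem hu hu', _, B.add_mem hv hv', by ring⟩
      neg_mem' := by
        rintro _ ⟨u, hu, v, hv, rfl⟩
        exact ⟨_, B.neg_mem hu, _, B.neg_mem hv, by ring⟩ }
  have hσΛ : ∀ u ∈ B, ∀ v ∈ B,
      σ (u * (1 + α) + v * (1 - α)) = v * (1 + α) + u * (1 - α) := by
    intro u hu v hv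
    simp only [map_add, map_mul, map_sub, map_one, hα, hu.1, hv.1]
    ring
  have hΛσ : ∀ x ∈ Λ, σ x ∈ Λ := by
    rintro _ ⟨u, hu, v, hv, rfl⟩
    exact ⟨v, hv, u, hu, hσΛ u hu v hv⟩
  have hΛr : ∀ x ∈ Λ, ‖x‖ < r := by
    have h₁ : ‖1 + α‖ ≤ max 1 ‖α‖ := by
      simpa using IsUltrametricDist.norm_add_le_max (1 : E) α
    have h₂ : ‖1 - α‖ ≤ max 1 ‖α‖ := by
      simpa [sub_eq_add_neg] using IsUltrametricDist.norm_add_le_max (1 : E) (-α)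
    rintro _ ⟨u, hu, v, hv, rfl⟩
    refine (IsUltrametricDist.norm_add_le_max _ _).trans_lt (max_lt ?_ ?_)
    · rw [norm_mul]
      exact (mul_le_mul_of_nonneg_left h₁ (norm_nonneg _)).trans_lt (hc0 u hu.2)
    · rw [norm_mul]
      exact (mul_le_mul_of_nonneg_left h₂ (norm_nonneg _)).trans_lt (hc0 v hv.2)
  have hΛ₀ : ∀ x ∈ Λ, σ x = x → ∃ y ∈ Λ, x = y + σ y := by
    rintro _ ⟨u, hu, v, hv, rfl⟩ h
    rw [hσΛ u hu v hv] at h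
    have huv : u = v := by
      have h' : (2 * α) * (u - v) = 0 := by linear_combination -h
      rcases mul_eq_zero.1 h' with h' | h'
      · exact absurd h' (mul_ne_zero two_ne_zero hα0)
      · exact sub_eq_zero.1 h'
    subst huv
    refine ⟨u * (1 + α) + 0 * (1 - α), ⟨u, hu, 0, B.zero_mem, rfl⟩, ?_⟩
    rw [hσΛ u hu 0 B.zero_mem]
    ring
  have hΛ₁ : ∀ x ∈ Λ, x + σ x = 0 → ∃ y ∈ Λ, x = y - σ y := by
    rintro _ ⟨u, hu, v, hv, rfl⟩ h
    rw [hσΛ u hu v hv] at h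
    have huv : v = -u := by
      have h' : 2 * (u + v) = 0 := by linear_combination h
      rcases mul_eq_zero.1 h' with h' | h'
      · exact absurd h' two_ne_zero
      · exact (neg_eq_of_add_eq_zero_right h').symm
    subst huv
    refine ⟨u * (1 + α) + 0 * (1 - α), ⟨u, hu, 0, B.zero_mem, rfl⟩, ?_⟩
    rw [hσΛ u hu 0 B.zero_mem]
    ring
  have hΛnhds : (Λ : Set E) ∈ 𝓝 (0 : E) := by
    have hσc : Continuous σ := (AddMonoidHomClass.isometry_of_norm σ hiso).continuous
    have h4 : (4 * α : E) ≠ 0 := mul_ne_zero (by norm_num) hα0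
    have hσ4 : σ (4 : E) = 4 := map_ofNat σ 4
    let f : E → E := fun x => (x * (1 + α) - σ x * (1 - α)) / (4 * α)
    let g : E → E := fun x => (σ x * (1 + α) - x * (1 - α)) / (4 * α)
    have hf : Continuous f := by fun_prop
    have hg : Continuous g := by fun_prop
    have hfU : f ⁻¹' Metric.ball 0 c ∈ 𝓝 (0 : E) :=
      hf.continuousAt (by simpa [f] using Metric.ball_mem_nhds (0 : E) hc)
    have hgU : g ⁻¹' Metric.ball 0 c ∈ 𝓝 (0 : E) :=
      hg.continuousAt (by simpa [g] using Metric.ball_mem_nhds (0 : E) hc)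
    filter_upwards [hfU, hgU] with x hfx hgx
    refine ⟨f x, ⟨?_, by simpa using hfx⟩, g x, ⟨?_, by simpa using hgx⟩, ?_⟩
    · simp only [f, map_div₀, map_sub, map_mul, map_add, map_one, hα, hσ, hσ4]
      field_simp
      ring
    · simp only [g, map_div₀, map_sub, map_mul, map_add, map_one, hα, hσ, hσ4]
      field_simp
      ring
    · simp only [f, g]
      field_simp
      ring
  have hexp0 : ∀ x ∈ Λ, exp x * exp (-x) = 1 := by
    intro x hx
    rw [← hadd x (-x) (hΛr x hx) (by rw [norm_neg]; exact hΛr x hx), add_neg_cancel, exp_zero]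
  let V : Subgroup Eˣ :=
    { carrier := {v | ∃ x ∈ Λ, (v : E) = exp x}
      one_mem' := ⟨0, Λ.zero_mem, by simp⟩
      mul_mem' := by
        rintro a b ⟨x, hx, hax⟩ ⟨y, hy, hby⟩
        exact ⟨x + y, Λ.add_mem hx hy, by
          rw [Units.val_mul, hax, hby, hadd x y (hΛr x hx) (hΛr y hy)]⟩
      inv_mem' := by
        rintro a ⟨x, hx, hax⟩
        refine ⟨-x, Λ.neg_mem hx, ?_⟩
        rw [Units.val_inv_eq_inv_val, hax]
        exact inv_eq_of_mul_eq_one_right (hexp0 x hx) }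
  have lift : ∀ x ∈ Λ, ∃ v ∈ V, (v : E) = exp x := fun x hx =>
    ⟨Units.mkOfMulEqOne _ _ (hexp0 x hx), ⟨x, hx, rfl⟩, rfl⟩
  have hσexp : ∀ x ∈ Λ, σ (exp x) = exp (σ x) := fun x hx => hequiv σ hiso x (hΛr x hx)
  have hval : ∀ v : Eˣ, ((Units.map (σ : E →* E) v : Eˣ) : E) = σ v := fun v => rfl
  refine ⟨V, ?_, ?_, ?_, ?_, ?_⟩
  · rintro v ⟨x, hx, hvx⟩
    exact ⟨σ x, hΛσ x hx, by rw [hval, hvx, hσexp x hx]⟩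
  · rintro v ⟨x, hx, hvx⟩ hv
    have hv' : σ v = v := by rw [← hval, hv]
    rw [hvx, hσexp x hx] at hv'
    obtain ⟨y, hy, rfl⟩ := hΛ₀ x hx
      (hinj _ _ (hΛr _ (hΛσ x hx)) (hΛr x hx) hv')
    obtain ⟨w, hw, hwy⟩ := lift y hy
    refine ⟨w, hw, Units.ext ?_⟩
    rw [Units.val_mul, hval, hvx, hwy, hσexp y hy,
      hadd _ _ (hΛr y hy) (hΛr _ (hΛσ y hy))]
  · rintro v ⟨x, hx, hvx⟩ hv
    have hv' : (v : E) * σ v = 1 := by rw [← hval, ← Units.val_mul, hv, Units.val_one]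
    rw [hvx, hσexp x hx, ← hadd _ _ (hΛr x hx) (hΛr _ (hΛσ x hx)), ← exp_zero] at hv'
    obtain ⟨y, hy, rfl⟩ := hΛ₁ x hx
      (hinj _ _ (hΛr _ (Λ.add_mem hx (hΛσ x hx))) (by simpa using hr) hv')
    obtain ⟨w, hw, hwy⟩ := lift y hy
    refine ⟨w, hw, ?_⟩
    rw [eq_div_iff_mul_eq']
    refine Units.ext ?_
    rw [Units.val_mul, hval, hvx, hwy, hσexp y hy,
      ← hadd _ _ (hΛr _ hx) (hΛr _ (hΛσ y hy)), sub_add_cancel]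
  · rintro v ⟨x, hx, hvx⟩
    have h := hone x (hΛr x hx)
    rw [← hvx] at h
    have h' := IsUltrametricDist.norm_add_eq_max_of_norm_ne_norm (x := (v : E) - 1) (y := 1)
      (by rw [norm_one]; exact h.ne)
    rwa [sub_add_cancel, norm_one, max_eq_right h.le] at h'
  · obtain ⟨ε, hε, hsub⟩ := Metric.mem_nhds_iff.1 (hopen _ hΛnhds)
    refine ⟨ε, hε, fun v hv => ?_⟩
    obtain ⟨x, hx, hxv⟩ := hsub (show (v : E) ∈ Metric.ball 1 ε by
      rwa [Metric.mem_ball, dist_eq_norm])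
    exact ⟨x, hx, hxv.symm⟩

end Exponential

section NormIndex

open Filter Topology

variable (p : ℕ) [Fact p.Prime]

/-- An open subgroup of the unit group of a `p`-adic field has finite index together with `p`. -/
theorem Padic.finiteIndex_sup_zpowers (E : Type*) [NormedField E] [NormedAlgebra ℚ_[p] E]
    [FiniteDimensional ℚ_[p] E] (V : Subgroup Eˣ)
    (hV : ∃ ε > 0, ∀ v : Eˣ, ‖(v : E) - 1‖ < ε → v ∈ V)
    (π : Eˣ) (hπ : ‖(π : E)‖ < 1) :
    (V ⊔ Subgroup.zpowers π).FiniteIndex := by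
  obtain ⟨ε, hε, hV⟩ := hV
  have : ProperSpace E := FiniteDimensional.proper ℚ_[p] E
  set W := V ⊔ Subgroup.zpowers π
  have hπ0 : 0 < ‖(π : E)‖ := norm_pos_iff.2 π.ne_zero
  let S : Set E := Metric.closedBall 0 1 \ Metric.ball 0 ‖(π : E)‖
  have hS : IsCompact S := (isCompact_closedBall 0 1).diff Metric.isOpen_ball
  have hS0 : ∀ x ∈ S, x ≠ 0 := by
    rintro x hx rfl
    exact hx.2 (by simp)
  have hU : ∀ x ∈ S, {y : E | ‖y / x - 1‖ < ε} ∈ 𝓝 x := by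
    intro x hx
    have hc : Continuous fun y : E => ‖y / x - 1‖ := by fun_prop
    refine hc.continuousAt.eventually (gt_mem_nhds ?_)
    beta_reduce
    rw [div_self (hS0 x hx), sub_self, norm_zero]
    exact hε
  obtain ⟨t, htS, ht⟩ := hS.elim_nhds_subcover _ hU
  have hscale : ∀ x : Eˣ, ∃ n : ℤ, ((x * π ^ n : Eˣ) : E) ∈ S := by
    intro x
    obtain ⟨n, hn₁, hn₂⟩ := exists_mem_Ioc_zpow (norm_pos_iff.2 x.ne_zero)
      ((one_lt_inv₀ hπ0).2 hπ)
    refine ⟨n + 1, ?_⟩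
    have hnorm : ‖((x * π ^ (n + 1) : Eˣ) : E)‖ = ‖(x : E)‖ * ‖(π : E)‖ ^ (n + 1) := by
      rw [Units.val_mul, Units.val_zpow_eq_zpow_val, norm_mul, norm_zpow]
    rw [inv_zpow, ← zpow_neg] at hn₁ hn₂
    have hz := zpow_pos hπ0 (n + 1)
    refine ⟨?_, ?_⟩
    · rw [mem_closedBall_zero_iff, hnorm]
      calc _ ≤ ‖(π : E)‖ ^ (-(n + 1)) * ‖(π : E)‖ ^ (n + 1) := by gcongr
        _ = 1 := by rw [← zpow_add₀ hπ0.ne']; simp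
    · rw [mem_ball_zero_iff, hnorm, not_lt]
      calc ‖(π : E)‖ = ‖(π : E)‖ ^ (-n) * ‖(π : E)‖ ^ (n + 1) := by
            rw [← zpow_add₀ hπ0.ne']; simp
        _ ≤ _ := by gcongr
  have hcover : ∀ q : Eˣ ⧸ W, ∃ z : t, ∃ y : Eˣ, (y : E) = z ∧ (y : Eˣ ⧸ W) = q := by
    intro q
    obtain ⟨x, rfl⟩ := QuotientGroup.mk_surjective q
    obtain ⟨n, hn⟩ := hscale x
    obtain ⟨z, hz, hxz⟩ := Set.mem_iUnion₂.1 (ht hn)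
    refine ⟨⟨z, hz⟩, Units.mk0 z (hS0 z (htS z hz)), rfl, ?_⟩
    rw [QuotientGroup.eq]
    have hv : (x * π ^ n) / Units.mk0 z (hS0 z (htS z hz)) ∈ V := by
      refine hV _ ?_
      simpa [Units.val_div_eq_div_val] using hxz
    have hx : (Units.mk0 z (hS0 z (htS z hz)))⁻¹ * x =
        ((x * π ^ n) / Units.mk0 z (hS0 z (htS z hz))) * π ^ (-n) := by
      rw [zpow_neg, div_eq_mul_inv, mul_right_comm, mul_inv_cancel_right, mul_comm]
    rw [hx]
    exact Subgroup.mul_mem_sup hv ⟨-n, rfl⟩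
  choose f y hy hyq using hcover
  have hf : Function.Injective f := by
    intro a b hab
    rw [← hyq a, ← hyq b]
    congr 1
    exact Units.ext (by rw [hy, hy, hab])
  have : Finite (Eˣ ⧸ W) := Finite.of_injective f hf
  exact Subgroup.finiteIndex_of_finite_quotient

/-- The norm index of a quadratic extension of `p`-adic fields is two: here the base field is the
fixed field of an involution `σ`. -/
theorem Padic.relIndex_norm_eq_two (E : Type*) [Field E] [Algebra ℚ_[p] E]
    [FiniteDimensional ℚ_[p] E] (σ : E ≃ₐ[ℚ_[p]] E) (hσ : ∀ x, σ (σ x) = x)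
    (α : E) (hα : σ α = -α) (hα0 : α ≠ 0) :
    (MonoidHom.id Eˣ * Units.map (σ : E →* E)).range.relIndex
      (MonoidHom.id Eˣ / Units.map (σ : E →* E)).ker = 2 := by
  let : NormedField E := spectralNorm.normedField ℚ_[p] E
  let : NormedAlgebra ℚ_[p] E := spectralNorm.normedAlgebra ℚ_[p] E
  have hiso : ∀ x : E, ‖σ x‖ = ‖x‖ := fun x => (spectralNorm_eq_of_equiv σ x).symm
  have : IsUltrametricDist E :=
    IsUltrametricDist.isUltrametricDist_of_isNonarchimedean_norm
      (isNonarchimedean_spectralNorm (K := ℚ_[p]) (L := E))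
  have : CompleteSpace E := FiniteDimensional.complete ℚ_[p] E
  have : CharZero E := charZero_of_injective_algebraMap (algebraMap ℚ_[p] E).injective
  obtain ⟨V, hV, hV₀, hV₁, hnorm, hopen⟩ :=
    Padic.exists_subgroup_cohomologically_trivial p E σ hσ hiso α hα hα0
  have hp0 : (p : E) ≠ 0 := by exact_mod_cast (Fact.out : p.Prime).ne_zero
  let π : Eˣ := Units.mk0 (p : E) hp0
  have hπ : ‖(π : E)‖ < 1 := by
    have h : ‖algebraMap ℚ_[p] E (p : ℚ_[p])‖ = ‖(p : ℚ_[p])‖ := norm_algebraMap' E _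
    rw [map_natCast] at h
    change ‖(p : E)‖ < 1
    rw [h]
    exact Padic.norm_p_lt_one
  have hπ0 : 0 < ‖(π : E)‖ := norm_pos_iff.2 π.ne_zero
  refine relIndex_range_norm_eq_two (Units.map (σ : E →* E))
    (fun x => Units.ext (hσ x)) ?_ V hV hV₀ hV₁ π (Units.ext (map_natCast σ p)) ?_
    (Padic.finiteIndex_sup_zpowers p E V hopen π hπ)
  · intro x hx
    have hx' : (x : E) * σ x = 1 := congrArg Units.val hx
    by_cases h1 : (x : E) = -1
    · refine ⟨Units.mk0 α hα0, ?_⟩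
      rw [eq_div_iff_mul_eq']
      refine Units.ext ?_
      change (x : E) * σ α = α
      rw [hα, h1]; ring
    · have hx1 : (1 : E) + x ≠ 0 := fun h => h1 (by linear_combination h)
      refine ⟨Units.mk0 (1 + x : E) hx1, ?_⟩
      rw [eq_div_iff_mul_eq']
      refine Units.ext ?_
      change (x : E) * σ (1 + x) = 1 + x
      rw [map_add, map_one, mul_add, hx']; ring
  · intro n hn
    have h := hnorm _ hn
    rw [Units.val_zpow_eq_zpow_val, norm_zpow] at h
    exact (zpow_eq_one_iff_right₀ hπ0.le hπ.ne).1 h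

end NormIndex

section QuadraticNorm

open QuadraticAlgebra

/-- The nonzero values of the binary quadratic form `u² - d v²`, as a subgroup of `Fˣ`. -/
def quadraticNormSubgroup {F : Type*} [Field F] (d : F) : Subgroup Fˣ :=
  (Units.map (QuadraticAlgebra.norm : QuadraticAlgebra F d 0 →* F)).range

theorem mem_quadraticNormSubgroup {F : Type*} [Field F] {d : F} {x : Fˣ} :
    x ∈ quadraticNormSubgroup d ↔ ∃ u v : F, (x : F) = u ^ 2 - d * v ^ 2 := by
  constructor
  · rintro ⟨z, rfl⟩
    refine ⟨(z : QuadraticAlgebra F d 0).re, (z : QuadraticAlgebra F d 0).im, ?_⟩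
    change QuadraticAlgebra.norm (z : QuadraticAlgebra F d 0) = _
    rw [QuadraticAlgebra.norm_def]; ring
  · rintro ⟨u, v, h⟩
    have hz : QuadraticAlgebra.norm (⟨u, v⟩ : QuadraticAlgebra F d 0) = x := by
      rw [QuadraticAlgebra.norm_def, h]; ring
    have hu : IsUnit (⟨u, v⟩ : QuadraticAlgebra F d 0) := by
      rw [isUnit_iff_norm_isUnit, hz]; exact x.isUnit
    exact ⟨hu.unit, Units.ext hz⟩

variable {F : Type*} [Field F]

theorem quadraticNormSubgroup_eq_top_of_isSquare [NeZero (2 : F)] {d : F} (hd0 : d ≠ 0)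
    (hd : IsSquare d) : quadraticNormSubgroup d = ⊤ := by
  obtain ⟨e, rfl⟩ := hd
  have he : e ≠ 0 := by rintro rfl; simp at hd0
  have h2 : (2 : F) ≠ 0 := NeZero.ne 2
  refine eq_top_iff.2 fun x _ => mem_quadraticNormSubgroup.2
    ⟨(x + 1) / 2, (x - 1) / (2 * e), ?_⟩
  field_simp
  ring

theorem mem_quadraticNormSubgroup_comm [NeZero (2 : F)] {a z : Fˣ} :
    z ∈ quadraticNormSubgroup (a : F) ↔ a ∈ quadraticNormSubgroup (z : F) := by
  suffices h : ∀ a z : Fˣ, z ∈ quadraticNormSubgroup (a : F) → a ∈ quadraticNormSubgroup (z : F)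
    from ⟨h a z, h z a⟩
  intro a z hz
  obtain ⟨u, v, h⟩ := mem_quadraticNormSubgroup.1 hz
  by_cases hv : v = 0
  · have hsq : IsSquare (z : F) := ⟨u, by rw [h, hv]; ring⟩
    rw [quadraticNormSubgroup_eq_top_of_isSquare z.ne_zero hsq]
    trivial
  · refine mem_quadraticNormSubgroup.2 ⟨u / v, 1 / v, ?_⟩
    field_simp
    rw [h]; ring

theorem Padic.index_quadraticNormSubgroup (p : ℕ) [Fact p.Prime] [Algebra ℚ_[p] F]
    [FiniteDimensional ℚ_[p] F] {d : F} (hd : ¬ IsSquare d) :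
    (quadraticNormSubgroup d).index = 2 := by
  have : Fact (∀ r : F, r ^ 2 ≠ d + 0 * r) :=
    ⟨fun r hr => hd ⟨r, by rw [← sq, hr]; ring⟩⟩
  have : CharZero F := charZero_of_injective_algebraMap (algebraMap ℚ_[p] F).injective
  let E := QuadraticAlgebra F d 0
  have : FiniteDimensional ℚ_[p] E := FiniteDimensional.trans ℚ_[p] F E
  let σ : E ≃ₐ[ℚ_[p]] E := AlgEquiv.ofRingEquiv
    (f := { toFun := star, invFun := star, left_inv := star_star, right_inv := star_star,
            map_mul' := fun x y => by rw [star_mul, mul_comm], map_add' := star_add })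
    (fun r => by
      change star (algebraMap ℚ_[p] E r) = algebraMap ℚ_[p] E r
      rw [IsScalarTower.algebraMap_apply ℚ_[p] F E]
      ext <;> simp [E])
  have hσ : ∀ x : E, σ x = star x := fun _ => rfl
  have key := Padic.relIndex_norm_eq_two p E σ (fun x => star_star x) (⟨0, 1⟩ : E)
    (by rw [hσ]; ext <;> simp [E]) (fun h => by simpa using congrArg QuadraticAlgebra.im h)
  let ι : Fˣ →* Eˣ := Units.map (algebraMap F E : F →* E)
  have hrange : (MonoidHom.id Eˣ / Units.map (σ : E →* E)).ker = ι.range := by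
    ext x
    rw [MonoidHom.mem_ker, MonoidHom.div_apply, div_eq_one]
    constructor
    · intro h
      have h' : (x : E) = star (x : E) := congrArg Units.val h
      have him : (x : E).im = 0 := by
        have := congrArg QuadraticAlgebra.im h'
        rw [im_star] at this
        exact self_eq_neg.1 this
      have hx : (x : E) = algebraMap F E (x : E).re := by
        ext <;> simp [E, him]
      have hre : (x : E).re ≠ 0 := fun h0 => x.ne_zero (by rw [hx, h0, map_zero])
      exact ⟨Units.mk0 _ hre, Units.ext hx.symm⟩
    · rintro ⟨y, rfl⟩
      refine Units.ext ?_
      change algebraMap F E y = star (algebraMap F E y)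
      ext <;> simp [E]
  have hcomap : (MonoidHom.id Eˣ * Units.map (σ : E →* E)).range.comap ι =
      quadraticNormSubgroup d := by
    have hval : ∀ z : Eˣ, (((MonoidHom.id Eˣ * Units.map (σ : E →* E)) z : Eˣ) : E) =
        algebraMap F E (QuadraticAlgebra.norm (z : E)) := fun z =>
      (algebraMap_norm_eq_mul_star (z : E)).symm
    ext x
    rw [Subgroup.mem_comap]
    constructor
    · rintro ⟨z, hz⟩
      refine ⟨z, Units.ext ((algebraMap F E).injective ?_)⟩
      have h := congrArg Units.val hz
      rw [hval] at h
      exact h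
    · rintro ⟨z, rfl⟩
      exact ⟨z, Units.ext (hval z)⟩
  rw [← hcomap, Subgroup.index_comap, ← hrange, key]

/-- The norm groups of `F(√a)` and `F(√(ab))` generate `Fˣ` when `b` is not a square. -/
theorem Padic.quadraticNormSubgroup_sup_eq_top (p : ℕ) [Fact p.Prime] [Algebra ℚ_[p] F]
    [FiniteDimensional ℚ_[p] F] {a b : Fˣ} (ha : ¬ IsSquare (a : F)) (hb : ¬ IsSquare (b : F))
    (hab : ¬ IsSquare (a * b : F)) :
    quadraticNormSubgroup (a : F) ⊔ quadraticNormSubgroup (a * b : F) = ⊤ := by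
  have : CharZero F := charZero_of_injective_algebraMap (algebraMap ℚ_[p] F).injective
  have index_two := fun {d : F} (hd : ¬ IsSquare d) => Padic.index_quadraticNormSubgroup p hd
  have max_of : ∀ {H M : Subgroup Fˣ}, H.index = 2 → H ≤ M → M ≠ ⊤ → H = M := by
    intro H M hH hHM hM
    refine le_antisymm hHM fun m hm => ?_
    by_contra hmH
    refine hM (eq_top_iff.2 fun x _ => ?_)
    by_cases hx : x ∈ H
    · exact hHM hx
    · have := hHM ((Subgroup.mul_mem_iff_of_index_two hH (a := x) (b := m)).2 (by tauto))
      exact (M.mul_mem_cancel_right hm).1 this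
  by_contra hne
  have heq : quadraticNormSubgroup (a : F) = quadraticNormSubgroup (a * b : F) :=
    (max_of (index_two ha) le_sup_left hne).trans (max_of (index_two hab) le_sup_right hne).symm
  have htop : quadraticNormSubgroup (b : F) = ⊤ := by
    refine eq_top_iff.2 fun z _ => mem_quadraticNormSubgroup_comm.2 ?_
    by_cases hz : IsSquare (z : F)
    · rw [quadraticNormSubgroup_eq_top_of_isSquare z.ne_zero hz]
      trivial
    · have h : a ∈ quadraticNormSubgroup (z : F) ↔ a * b ∈ quadraticNormSubgroup (z : F) := by
        rw [← mem_quadraticNormSubgroup_comm, heq, ← Units.val_mul, mem_quadraticNormSubgroup_comm]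
      rw [Subgroup.mul_mem_iff_of_index_two (index_two hz)] at h
      tauto
  have := index_two hb
  rw [htop, Subgroup.index_top] at this
  norm_num at this

end QuadraticNorm

section Biquadratic

variable {F L : Type*} [Field F] [Field L] [Algebra F L]

/-- For distinct commuting involutions `σ`, `τ` there is an element fixed by `σ` and negated
by `τ`. -/
theorem exists_fixed_and_negated [FiniteDimensional F L] (σ τ : L ≃ₐ[F] L) (hσ : σ * σ = 1)
    (hτ : τ * τ = 1) (hcomm : σ * τ = τ * σ) (hτ1 : τ ≠ 1) (hτσ : τ ≠ σ) :
    ∃ α : L, α ≠ 0 ∧ σ α = α ∧ τ α = -α := by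
  have hσ2 : σ ^ 2 = 1 := by rw [sq, hσ]
  have hmem : τ ∉ Subgroup.zpowers σ := by
    rintro ⟨n, hn⟩
    rcases Int.even_or_odd' n with ⟨k, rfl | rfl⟩
    · exact hτ1 (by simp [← hn, zpow_mul, hσ2])
    · exact hτσ (by simp [← hn, zpow_add, zpow_mul, hσ2])
  rw [← IntermediateField.fixingSubgroup_fixedField (Subgroup.zpowers σ),
    IntermediateField.mem_fixingSubgroup_iff] at hmem
  push Not at hmem
  obtain ⟨e, he, hτe⟩ := hmem
  have hσe : σ e = e :=
    IntermediateField.mem_fixedField_iff _ _ |>.1 he σ (Subgroup.mem_zpowers σ)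
  have hστe : σ (τ e) = τ e := by
    rw [← AlgEquiv.mul_apply, hcomm, AlgEquiv.mul_apply, hσe]
  have hττe : τ (τ e) = e := by rw [← AlgEquiv.mul_apply, hτ, AlgEquiv.one_apply]
  refine ⟨e - τ e, sub_ne_zero.2 (Ne.symm hτe), ?_, ?_⟩
  · rw [map_sub, hσe, hστe]
  · rw [map_sub, hττe, neg_sub]

/-- If the square of an element which is negated by some automorphism lies in the base field, then
it is not a square there. -/
theorem not_isSquare_of_negated [CharZero L] (τ : L ≃ₐ[F] L) {γ : L} (hγ0 : γ ≠ 0)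
    (hτ : τ γ = -γ) {c : F} (hc : algebraMap F L c = γ ^ 2) : ¬ IsSquare c := by
  rintro ⟨r, rfl⟩
  rw [map_mul, ← sq] at hc
  have hfix : τ γ = γ := by
    rcases sq_eq_sq_iff_eq_or_eq_neg.1 hc with h | h
    · rw [← h, τ.commutes]
    · rw [← neg_eq_iff_eq_neg.2 h, map_neg, τ.commutes]
  rw [hτ, neg_eq_self] at hfix
  exact hγ0 hfix

end Biquadratic

/-- If `L/F` is a biquadratic extension of a `p`-adic field `F` and `K` is a quadratic
intermediate field, then every element of `F^*` is a norm from `L^*` to `K^*`. -/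
theorem stmt_4 (p : ℕ) [Fact p.Prime]
    (F K L : Type*) [Field F] [Field K] [Field L]
    [Algebra ℚ_[p] F] [FiniteDimensional ℚ_[p] F]
    [Algebra F K] [Algebra K L] [Algebra F L] [IsScalarTower F K L]
    [IsGalois F L] (hL : Module.finrank F L = 4)
    (hGal : Nonempty ((L ≃ₐ[F] L) ≃* Multiplicative (ZMod 2 × ZMod 2)))
    (hK : Module.finrank F K = 2) :
    ∀ x : F, x ≠ 0 → ∃ y : L, y ≠ 0 ∧ Algebra.norm K y = algebraMap F K x := by
  intro x hx
  obtain ⟨φ⟩ := hGal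
  have : CharZero F := charZero_of_injective_algebraMap (algebraMap ℚ_[p] F).injective
  have : CharZero L := charZero_of_injective_algebraMap (algebraMap F L).injective
  have : FiniteDimensional F L := Module.finite_of_finrank_pos (by rw [hL]; norm_num)
  have : FiniteDimensional K L := FiniteDimensional.right F K L
  have : IsGalois K L := IsGalois.tower_top_of_isGalois F K L
  have hKL : Module.finrank K L = 2 := by
    have h := Module.finrank_mul_finrank F K L
    rw [hK, hL] at h
    lia
  have hcard : Nat.card (L ≃ₐ[K] L) = 2 := by rw [IsGalois.card_aut_eq_finrank, hKL]
  obtain ⟨τK, hτK1, hτKuniv⟩ := (Nat.card_eq_two_iff' (1 : L ≃ₐ[K] L)).1 hcard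
  let τ : L ≃ₐ[F] L := τK.restrictScalars F
  have hτ1 : τ ≠ 1 := fun h => hτK1 (AlgEquiv.ext fun z => congrArg (fun f => f z) h)
  obtain ⟨σ, hσ1, hστ⟩ : ∃ σ : L ≃ₐ[F] L, σ ≠ 1 ∧ σ ≠ τ := by
    have h : ∀ t : Multiplicative (ZMod 2 × ZMod 2), ∃ s, s ≠ 1 ∧ s ≠ t := by decide
    obtain ⟨s, hs1, hst⟩ := h (φ τ)
    refine ⟨φ.symm s, fun h => hs1 ?_, fun h => hst ?_⟩
    · rw [← φ.apply_symm_apply s, h, map_one]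
    · rw [← φ.apply_symm_apply s, h]
  have hsq : ∀ g : L ≃ₐ[F] L, g * g = 1 := by
    have h : ∀ t : Multiplicative (ZMod 2 × ZMod 2), t * t = 1 := by decide
    exact fun g => φ.injective (by rw [map_mul, h, map_one])
  have hcomm : ∀ g h : L ≃ₐ[F] L, g * h = h * g :=
    fun g h => φ.injective (by rw [map_mul, map_mul, mul_comm])
  have hall : ∀ g : L ≃ₐ[F] L, g = 1 ∨ g = σ ∨ g = τ ∨ g = σ * τ := by
    have h : ∀ s t g : Multiplicative (ZMod 2 × ZMod 2), s ≠ 1 ∧ t ≠ 1 ∧ s ≠ t →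
        g = 1 ∨ g = s ∨ g = t ∨ g = s * t := by decide
    intro g
    have hg := h (φ σ) (φ τ) (φ g) ⟨by simpa using hσ1, by simpa using hτ1, by simpa using hστ⟩
    simpa only [← map_mul, ← map_one φ, φ.injective.eq_iff] using hg
  obtain ⟨α, hα0, hσα, hτα⟩ :=
    exists_fixed_and_negated σ τ (hsq σ) (hsq τ) (hcomm σ τ) hτ1 hστ.symm
  obtain ⟨β, hβ0, hτβ, hσβ⟩ :=
    exists_fixed_and_negated τ σ (hsq τ) (hsq σ) (hcomm τ σ) hσ1 hστ
  have hbase : ∀ z : L, σ z = z → τ z = z → ∃ c : F, algebraMap F L c = z := by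
    intro z hσz hτz
    refine (IsGalois.mem_range_algebraMap_iff_fixed z).2 fun g => ?_
    rcases hall g with rfl | rfl | rfl | rfl
    · rfl
    · exact hσz
    · exact hτz
    · rw [AlgEquiv.mul_apply, hτz, hσz]
  obtain ⟨a, ha⟩ := hbase (α ^ 2) (by rw [map_pow, hσα]) (by rw [map_pow, hτα, neg_sq])
  obtain ⟨b, hb⟩ := hbase (β ^ 2) (by rw [map_pow, hσβ, neg_sq]) (by rw [map_pow, hτβ])
  have hab : algebraMap F L (a * b) = (α * β) ^ 2 := by rw [map_mul, ha, hb, mul_pow]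
  have hταβ : τ (α * β) = -(α * β) := by rw [map_mul, hτα, hτβ, neg_mul]
  have ha0 : a ≠ 0 := by
    rintro rfl
    exact pow_ne_zero 2 hα0 (by rw [← ha, map_zero])
  have hb0 : b ≠ 0 := by
    rintro rfl
    exact pow_ne_zero 2 hβ0 (by rw [← hb, map_zero])
  have htop := Padic.quadraticNormSubgroup_sup_eq_top p (a := Units.mk0 a ha0)
    (b := Units.mk0 b hb0) (not_isSquare_of_negated τ hα0 hτα ha)
    (not_isSquare_of_negated σ hβ0 hσβ hb)
    (not_isSquare_of_negated τ (mul_ne_zero hα0 hβ0) hταβ hab)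
  obtain ⟨m, hm, n, hn, hmn⟩ := Subgroup.mem_sup.1 (htop ▸ Subgroup.mem_top (Units.mk0 x hx))
  obtain ⟨u, v, huv⟩ := mem_quadraticNormSubgroup.1 hm
  obtain ⟨s, t, hst⟩ := mem_quadraticNormSubgroup.1 hn
  let i := algebraMap F L
  let y : L := (i u + i v * α) * (i s + i t * (α * β))
  have hτi : ∀ c : F, τ (i c) = i c := τ.commutes
  have hy : y * τ y = i x := by
    have hxmn : x = (u ^ 2 - a * v ^ 2) * (s ^ 2 - a * b * t ^ 2) := by
      have h := congrArg Units.val hmn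
      rw [Units.val_mul, huv, hst] at h
      exact h.symm
    simp only [y, map_mul, map_add, hτi, hτα, hτβ, hxmn, map_sub, map_pow]
    simp only [i, ha, hb]
    ring
  have hnorm : algebraMap K L (Algebra.norm K y) = y * τ y := by
    classical
    rw [Algebra.norm_eq_prod_automorphisms]
    have huniv : (Finset.univ : Finset (L ≃ₐ[K] L)) = {1, τK} := by
      ext g
      simp only [Finset.mem_univ, Finset.mem_insert, Finset.mem_singleton, true_iff]
      exact or_iff_not_imp_left.2 (hτKuniv g)
    rw [huniv, Finset.prod_pair hτK1.symm]
    rfl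
  refine ⟨y, ?_, (algebraMap K L).injective ?_⟩
  · intro h0
    rw [h0, zero_mul] at hy
    exact hx ((map_eq_zero i).1 hy.symm)
  · rw [hnorm, hy, ← IsScalarTower.algebraMap_apply F K L]
end

section
/- Let F be a finite extension of ℚ_p and let L be a cyclic extension of F of degree 4, i.e., L/F is Galois with Gal(L/F) isomorphic to ℤ/4ℤ. Let K be the unique intermediate field with [K : F] = 2. Then F^* is not contained in N_{L/K}(L^*): there exists x ∈ F^* which is not of the form N_{L/K}(y) for any y ∈ L^*. -/
/-- For a subgroup `V` of finite index in a commutative group, the indices of the squares in the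
group and in `V` differ by the index of the `2`-torsion of `V`. -/
theorem index_range_sq_mul {A : Type*} [CommGroup A] (V : Subgroup A) (hV : V.index ≠ 0) :
    (powMonoidHom 2 : A →* A).range.index =
      V.relIndex (powMonoidHom 2 : A →* A).ker * (V.map (powMonoidHom 2)).relIndex V := by
  set f := (powMonoidHom 2 : A →* A)
  have hle : V.map f ≤ V := by
    rintro _ ⟨v, hv, rfl⟩
    exact V.pow_mem hv 2
  have h1 := Subgroup.index_map V f
  have h2 := Subgroup.relIndex_mul_index hle
  have h3 := Subgroup.relIndex_mul_index (le_sup_left : V ≤ V ⊔ f.ker)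
  rw [Subgroup.relIndex_sup_left] at h3
  have h4 : (V ⊔ f.ker).index ≠ 0 := fun h => hV (by rw [← h3, h, mul_zero])
  apply Nat.eq_of_mul_eq_mul_left (Nat.pos_of_ne_zero h4)
  rw [← h1, ← h2, ← h3]
  ring

/-- The principal congruence subgroup of units congruent to `1` modulo `a`. -/
def unitsOneAdd {O : Type*} [CommRing O] (a : O) : Subgroup Oˣ :=
  (Units.map (Ideal.Quotient.mk (Ideal.span {a}) : O →* O ⧸ Ideal.span {a})).ker

theorem mem_unitsOneAdd {O : Type*} [CommRing O] {a : O} {u : Oˣ} :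
    u ∈ unitsOneAdd a ↔ ∃ t, (u : O) = 1 + a * t := by
  rw [unitsOneAdd, MonoidHom.mem_ker, Units.ext_iff]
  simp only [Units.coe_map, MonoidHom.coe_coe, Units.val_one]
  rw [← map_one (Ideal.Quotient.mk (Ideal.span {a})), Ideal.Quotient.eq,
    Ideal.mem_span_singleton]
  exact exists_congr fun t => sub_eq_iff_eq_add'

theorem isUnit_one_add_mul {O : Type*} [CommRing O] [IsLocalRing O] {a : O} (ha : ¬IsUnit a)
    (t : O) : IsUnit (1 + a * t) := by
  refine (IsLocalRing.isUnit_or_isUnit_of_add_one (add_neg_cancel_right 1 (a * t))).resolve_right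
    fun h => ha (isUnit_of_mul_isUnit_left (y := t) ?_)
  simpa using h.neg

section Units

variable {O : Type*} [CommRing O] [IsLocalRing O] {q : O}

/-- If `x + q * x ^ 2` is surjective, squaring maps `1 + 2qO` onto `1 + 4qO`. -/
theorem map_sq_unitsOneAdd (hq : ¬IsUnit q) (hs : ∀ y : O, ∃ x, x + q * x ^ 2 = y) :
    (unitsOneAdd (2 * q)).map (powMonoidHom 2) = unitsOneAdd (4 * q) := by
  ext u
  simp only [Subgroup.mem_map, mem_unitsOneAdd, powMonoidHom_apply]
  constructor
  · rintro ⟨v, ⟨t, ht⟩, rfl⟩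
    refine ⟨t + q * t ^ 2, ?_⟩
    rw [Units.val_pow_eq_pow_val, ht]
    ring
  · rintro ⟨y, hy⟩
    obtain ⟨x, rfl⟩ := hs y
    have h2 : ¬IsUnit (2 * q) := fun h => hq (isUnit_of_mul_isUnit_right h)
    refine ⟨(isUnit_one_add_mul h2 x).unit, ⟨x, rfl⟩, ?_⟩
    ext
    rw [Units.val_pow_eq_pow_val, hy, IsUnit.unit_spec]
    ring

theorem relIndex_unitsOneAdd [IsDomain O] (hq : ¬IsUnit q) (hq0 : q ≠ 0) (h20 : (2 : O) ≠ 0) :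
    (unitsOneAdd (4 * q)).relIndex (unitsOneAdd (2 * q)) =
      Nat.card (O ⧸ Ideal.span {(2 : O)}) := by
  have h2q : (2 * q : O) ≠ 0 := mul_ne_zero h20 hq0
  choose c hc using fun u : unitsOneAdd (2 * q) => mem_unitsOneAdd.1 u.2
  let φ : unitsOneAdd (2 * q) →* Multiplicative (O ⧸ Ideal.span {(2 : O)}) :=
    MonoidHom.mk' (fun u => .ofAdd (Ideal.Quotient.mk _ (c u))) <| by
      intro u v
      rw [← ofAdd_add, ← map_add]
      congr 1
      rw [Ideal.Quotient.eq, Ideal.mem_span_singleton]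
      refine ⟨q * c u * c v, mul_left_cancel₀ h2q ?_⟩
      have := hc (u * v)
      rw [Subgroup.coe_mul, Units.val_mul, hc u, hc v] at this
      linear_combination -this
  have hker : (unitsOneAdd (4 * q)).subgroupOf (unitsOneAdd (2 * q)) = φ.ker := by
    ext u
    rw [Subgroup.mem_subgroupOf, MonoidHom.mem_ker, mem_unitsOneAdd]
    change _ ↔ Ideal.Quotient.mk _ (c u) = 0
    rw [Ideal.Quotient.eq_zero_iff_mem, Ideal.mem_span_singleton, hc u]
    refine exists_congr fun t => ⟨fun h => mul_left_cancel₀ h2q ?_, fun h => ?_⟩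
    · linear_combination h
    · rw [h]; ring
  have hsurj : Function.Surjective φ := by
    intro y
    obtain ⟨t, ht⟩ := Ideal.Quotient.mk_surjective y.toAdd
    have h2 : ¬IsUnit (2 * q) := fun h => hq (isUnit_of_mul_isUnit_right h)
    let u : unitsOneAdd (2 * q) := ⟨(isUnit_one_add_mul h2 t).unit, mem_unitsOneAdd.2 ⟨t, rfl⟩⟩
    have hu : c u = t := mul_left_cancel₀ h2q (add_left_cancel (hc u)).symm
    exact ⟨u, by rw [← ofAdd_toAdd y, ← ht, ← hu]; rfl⟩
  rw [Subgroup.relIndex, hker, Subgroup.index_ker, MonoidHom.range_eq_top.2 hsurj,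
    Subgroup.card_top]
  exact Nat.card_congr Multiplicative.toAdd

/-- If `x + q * x ^ 2` is surjective on `O` for some nonzero nonunit `q`, then
`[Oˣ : Oˣ²] = 2 * #(O / 2)`. -/
theorem index_range_sq_units [IsDomain O] (hq : ¬IsUnit q) (hq0 : q ≠ 0) (h20 : (2 : O) ≠ 0)
    (hs : ∀ y : O, ∃ x, x + q * x ^ 2 = y) [Finite (O ⧸ Ideal.span {2 * q})] :
    (powMonoidHom 2 : Oˣ →* Oˣ).range.index = 2 * Nat.card (O ⧸ Ideal.span {(2 : O)}) := by
  have hfin : (unitsOneAdd (2 * q)).index ≠ 0 := by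
    rw [unitsOneAdd, Subgroup.index_ker]
    exact Nat.card_pos.ne'
  have hneg : (-1 : Oˣ) ∉ unitsOneAdd (2 * q) := by
    rw [mem_unitsOneAdd]
    rintro ⟨t, ht⟩
    rw [Units.val_neg, Units.val_one] at ht
    refine hq (IsUnit.of_mul_eq_one (-t) (mul_left_cancel₀ h20 ?_))
    linear_combination ht
  have hker : ∀ u : Oˣ, u ∈ (powMonoidHom 2 : Oˣ →* Oˣ).ker ↔ u = 1 ∨ u = -1 := by
    intro u
    rw [MonoidHom.mem_ker, powMonoidHom_apply, Units.ext_iff, Units.val_pow_eq_pow_val,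
      Units.val_one, ← one_pow 2, sq_eq_sq_iff_eq_or_eq_neg, Units.ext_iff, Units.ext_iff,
      Units.val_neg, Units.val_one]
  rw [index_range_sq_mul _ hfin, map_sq_unitsOneAdd hq hs, relIndex_unitsOneAdd hq hq0 h20]
  congr 1
  rw [Subgroup.relIndex_eq_two_iff]
  refine ⟨-1, (hker _).2 (.inr rfl), fun b hb => ?_⟩
  rcases (hker b).1 hb with rfl | rfl
  · exact .inr ⟨one_mem _, by rwa [one_mul]⟩
  · exact .inl ⟨by rw [neg_mul_neg, one_mul]; exact one_mem _, hneg⟩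
end Units

theorem zpow_irreducible_ne_unit {O F : Type*} [CommRing O] [Field F] [Algebra O F]
    [IsFractionRing O F] {π : O} (hπ : Irreducible π) {n : ℤ} (hn : n ≠ 0) (u : Oˣ) :
    algebraMap O F π ^ n ≠ algebraMap O F u := by
  have key : ∀ (m : ℕ) (v : Oˣ), m ≠ 0 → algebraMap O F π ^ m ≠ algebraMap O F v := by
    intro m v hm h
    rw [← map_pow, (IsFractionRing.injective O F).eq_iff] at h
    exact hπ.not_isUnit ((isUnit_pow_iff hm).1 (h ▸ v.isUnit))
  intro h
  obtain ⟨m, rfl | rfl⟩ := n.eq_nat_or_neg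
  · exact key m u (by simpa using hn) (by simpa using h)
  · refine key m u⁻¹ (by simpa using hn) ?_
    rw [zpow_neg, zpow_natCast, inv_eq_iff_eq_inv] at h
    rw [h]
    exact inv_eq_of_mul_eq_one_right (by rw [← map_mul, Units.mul_inv, map_one])

section FractionField

variable {O F : Type*} [CommRing O] [IsDomain O] [IsDiscreteValuationRing O] [Field F]
  [Algebra O F] [IsFractionRing O F]

/-- A nonzero element of the fraction field is a unit times a power of a uniformizer. -/
theorem exists_unit_mul_zpow {π : O} (hπ : Irreducible π) (x : Fˣ) :
    ∃ (u : Oˣ) (n : ℤ), (x : F) = algebraMap O F u * algebraMap O F π ^ n := by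
  have hπ0 : algebraMap O F π ≠ 0 := by simpa using hπ.ne_zero
  obtain ⟨a, b, hb, hx⟩ := IsFractionRing.div_surjective (A := O) (x : F)
  have hb0 : b ≠ 0 := nonZeroDivisors.ne_zero hb
  have ha0 : a ≠ 0 := by
    rintro rfl
    exact x.ne_zero (by rw [← hx, map_zero, zero_div])
  obtain ⟨m, u, rfl⟩ := IsDiscreteValuationRing.eq_unit_mul_pow_irreducible ha0 hπ
  obtain ⟨n, v, rfl⟩ := IsDiscreteValuationRing.eq_unit_mul_pow_irreducible hb0 hπ
  have hv : algebraMap O F v ≠ 0 := by simp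
  refine ⟨u * v⁻¹, m - n, ?_⟩
  have hvi : algebraMap O F (v⁻¹ : Oˣ) = (algebraMap O F v)⁻¹ :=
    eq_inv_of_mul_eq_one_left (by rw [← map_mul, Units.inv_mul, map_one])
  rw [← hx, zpow_sub₀ hπ0, zpow_natCast, zpow_natCast, Units.val_mul, map_mul, map_mul, map_mul,
    map_pow, map_pow, hvi]
  field_simp

/-- The fraction field of a discrete valuation ring has twice as many square classes as its
unit group. -/
theorem index_range_sq_fractionField :
    (powMonoidHom 2 : Fˣ →* Fˣ).range.index = 2 * (powMonoidHom 2 : Oˣ →* Oˣ).range.index := by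
  obtain ⟨π, hπ⟩ := IsDiscreteValuationRing.exists_irreducible O
  have hπ0 : algebraMap O F π ≠ 0 := by simpa using hπ.ne_zero
  have hinj := IsFractionRing.injective O F
  set ι : Oˣ →* Fˣ := Units.map (algebraMap O F : O →* F)
  have hιv : ∀ u, (ι u : F) = algebraMap O F u := fun u => rfl
  set S := (powMonoidHom 2 : Fˣ →* Fˣ).range
  have hcomap : S.comap ι = (powMonoidHom 2 : Oˣ →* Oˣ).range := by
    ext u
    simp only [S, Subgroup.mem_comap, MonoidHom.mem_range, powMonoidHom_apply]
    constructor
    · rintro ⟨x, hx⟩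
      have hint : ∀ (y : Fˣ) (v : Oˣ), y ^ 2 = ι v → ∃ z, algebraMap O F z = y := by
        intro y v hy
        have hy' : (y : F) ^ 2 = algebraMap O F v := by
          rw [← hιv, ← hy, Units.val_pow_eq_pow_val]
        exact IsIntegrallyClosed.isIntegral_iff.1
          (IsIntegral.of_pow two_pos (hy' ▸ isIntegral_algebraMap))
      obtain ⟨z, hz⟩ := hint x u hx
      have hzu : z ^ 2 = u := by
        apply hinj
        rw [map_pow, hz, ← hιv, ← hx, Units.val_pow_eq_pow_val]
      have : IsUnit z := (isUnit_pow_iff two_ne_zero).1 (hzu ▸ u.isUnit)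
      exact ⟨this.unit, Units.ext (by rw [Units.val_pow_eq_pow_val, IsUnit.unit_spec, hzu])⟩
    · rintro ⟨v, rfl⟩
      exact ⟨ι v, by rw [map_pow]⟩
  have hidx : (S ⊔ ι.range).index = 2 := by
    have hmem : ∀ x : Fˣ, x ∈ S ⊔ ι.range ↔ ∃ (y : Fˣ) (u : Oˣ), y ^ 2 * ι u = x := by
      intro x
      simp [Subgroup.mem_sup, S]
    set ϖ : Fˣ := Units.mk0 _ hπ0
    rw [Subgroup.index_eq_two_iff]
    refine ⟨ϖ, fun b => ?_⟩
    obtain ⟨u, n, hb⟩ := exists_unit_mul_zpow hπ b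
    have hb' : b = ι u * ϖ ^ n := Units.ext (by simpa [hιv, ϖ] using hb)
    have hodd : ∀ m : ℤ, ι u * ϖ ^ m ∈ S ⊔ ι.range ↔ Even m := by
      intro m
      rw [hmem]
      constructor
      · rintro ⟨y, v, hy⟩
        obtain ⟨w, k, hk⟩ := exists_unit_mul_zpow hπ y
        have hk' : y = ι w * ϖ ^ k := Units.ext (by simpa [hιv, ϖ] using hk)
        by_contra hm
        have hmk : m - 2 * k ≠ 0 := fun h => hm ⟨k, by omega⟩
        refine zpow_irreducible_ne_unit (F := F) hπ hmk (w ^ 2 * v * u⁻¹) ?_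
        have : ϖ ^ (m - 2 * k) = ι (w ^ 2 * v * u⁻¹) := by
          rw [map_mul, map_mul, map_pow, map_inv, eq_mul_inv_iff_mul_eq, zpow_sub,
            mul_right_comm, mul_comm _ (ι u), ← hy, hk', mul_pow, ← zpow_natCast (ϖ ^ k),
            ← zpow_mul, mul_comm k, mul_inv_eq_iff_eq_mul]
          push_cast
          ac_rfl
        simpa [ϖ, hιv, Units.ext_iff] using this
      · rintro ⟨k, rfl⟩
        exact ⟨ϖ ^ k, u, by rw [zpow_add, sq, mul_comm]⟩
    rw [hb', mul_assoc, ← zpow_add_one, hodd, hodd, Int.even_add_one]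
    by_cases hn : Even n
    · exact .inr ⟨hn, not_not.2 hn⟩
    · exact .inl ⟨hn, hn⟩
  rw [← hcomap, Subgroup.index_comap,
    ← Subgroup.relIndex_mul_index (le_sup_left : S ≤ S ⊔ ι.range), Subgroup.relIndex_sup_left,
    hidx, mul_comm]

end FractionField

theorem isPrecomplete_of_free {R M : Type*} [CommRing R] [AddCommGroup M] [Module R M]
    (I : Ideal R) [IsPrecomplete I R] [Module.Free R M] [Module.Finite R M] :
    IsPrecomplete I M where
  prec' f hf := by
    let b := Module.Free.chooseBasis R M
    have hb : ∀ i, ∃ l : R, ∀ n, b.repr (f n) i ≡ l [SMOD I ^ n • (⊤ : Submodule R R)] := by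
      intro i
      refine IsPrecomplete.prec inferInstance fun {m n} hmn => ?_
      have h := SModEq.map (hf hmn) (b.coord i)
      rw [Submodule.map_smul''] at h
      exact h.mono (Submodule.smul_mono le_rfl le_top)
    choose l hl using hb
    refine ⟨∑ i, l i • b i, fun n => ?_⟩
    rw [SModEq.sub_mem, ← b.sum_repr (f n), ← Finset.sum_sub_distrib]
    refine Submodule.sum_mem _ fun i _ => ?_
    rw [← sub_smul]
    refine Submodule.smul_mem_smul ?_ trivial
    have := SModEq.sub_mem.1 (hl i n)
    simpa using this

theorem card_quotient_span_algebraMap {R S : Type*} [CommRing R] [Nontrivial R] [CommRing S]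
    [Algebra R S] [Module.Free R S] [Module.Finite R S] (a : R) :
    Nat.card (S ⧸ Ideal.span {algebraMap R S a}) =
      Nat.card (R ⧸ Ideal.span {a}) ^ Module.finrank R S := by
  let b := Module.Free.chooseBasis R S
  let φ : S →ₗ[R] (Module.Free.ChooseBasisIndex R S → R ⧸ Ideal.span {a}) :=
    LinearMap.pi fun i => (Submodule.mkQ (Ideal.span {a})).comp (b.coord i)
  have hφ : ∀ s i, φ s i = Ideal.Quotient.mk _ (b.repr s i) := fun s i => rfl
  have hsurj : Function.Surjective φ := by
    intro y
    choose c hc using fun i => Ideal.Quotient.mk_surjective (y i)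
    exact ⟨∑ i, c i • b i, funext fun i => by rw [hφ, b.repr_sum_self, hc]⟩
  have hker : φ.ker = (Ideal.span {algebraMap R S a}).restrictScalars R := by
    ext s
    rw [LinearMap.mem_ker, Submodule.restrictScalars_mem, Ideal.mem_span_singleton]
    constructor
    · intro h
      have h' : ∀ i, a ∣ b.repr s i := by
        intro i
        rw [← Ideal.mem_span_singleton, ← Ideal.Quotient.eq_zero_iff_mem, ← hφ, h]
        rfl
      choose c hc using h'
      refine ⟨∑ i, c i • b i, ?_⟩
      rw [← Algebra.smul_def, Finset.smul_sum]
      conv_lhs => rw [← b.sum_repr s]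
      simp_rw [hc, mul_smul]
    · rintro ⟨t, rfl⟩
      ext i
      rw [hφ, ← Algebra.smul_def, map_smul, Finsupp.smul_apply, smul_eq_mul]
      exact Ideal.Quotient.eq_zero_iff_mem.2
        (Ideal.mul_mem_right _ _ (Ideal.mem_span_singleton_self a))
  have e : (S ⧸ Ideal.span {algebraMap R S a}) ≃
      (Module.Free.ChooseBasisIndex R S → R ⧸ Ideal.span {a}) :=
    (Submodule.Quotient.restrictScalarsEquiv R (Ideal.span {algebraMap R S a})).symm.toEquiv.trans
      ((Submodule.quotEquivOfEq _ _ hker.symm).trans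
        (φ.quotKerEquivOfSurjective hsurj)).toEquiv
  rw [Nat.card_congr e, Nat.card_fun, Module.finrank_eq_card_chooseBasisIndex,
    Nat.card_eq_fintype_card (α := Module.Free.ChooseBasisIndex R S)]

theorem PadicInt.finite_quotient_span {p : ℕ} [Fact p.Prime] {a : ℤ_[p]} (ha : a ≠ 0) :
    Finite (ℤ_[p] ⧸ Ideal.span {a}) := by
  have hspan : Ideal.span {a} = Ideal.span {(p : ℤ_[p]) ^ a.valuation} := by
    rw [Ideal.span_singleton_eq_span_singleton]
    exact .symm ⟨PadicInt.unitCoeff ha, by rw [mul_comm, ← PadicInt.unitCoeff_spec ha]⟩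
  rw [hspan, ← PadicInt.ker_toZModPow]
  have : NeZero (p ^ a.valuation) := ⟨pow_ne_zero _ (Fact.out : p.Prime).ne_zero⟩
  exact Finite.of_injective _ (RingHom.kerLift_injective (PadicInt.toZModPow (p := p) a.valuation))

/-- Hensel's lemma for `x + a * x ^ 2 = y` in a finite free extension of an `a`-adically complete
ring. -/
theorem exists_add_mul_sq_eq {R O : Type*} [CommRing R] [CommRing O] [Algebra R O] [IsDomain O]
    [Module.Free R O] [Module.Finite R O] {a : R} [IsAdicComplete (Ideal.span {a}) R]
    [IsHausdorff (Ideal.span {a}) O] (ha : algebraMap R O a ≠ 0) (y : O) :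
    ∃ x : O, x + algebraMap R O a * x ^ 2 = y := by
  set q := algebraMap R O a
  have : IsPrecomplete (Ideal.span {a}) O := isPrecomplete_of_free _
  have hc : IsAdicComplete (Ideal.span {a}) O := {}
  have hc : IsAdicComplete (Ideal.span {q}) O := by
    rw [← IsAdicComplete.map_algebraMap_iff (S := O), Ideal.map_span, Set.image_singleton] at hc
    exact hc
  open Polynomial in
  obtain ⟨z, hz, hzq⟩ := HenselianRing.is_henselian (I := Ideal.span {q})
    (X ^ 2 + X - C (q * y) : O[X]) (by monicity!) 0
    (by simp [Ideal.mem_span_singleton]) (by simp)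
  rw [sub_zero, Ideal.mem_span_singleton] at hzq
  obtain ⟨x, rfl⟩ := hzq
  refine ⟨x, mul_left_cancel₀ ha ?_⟩
  simp [Polynomial.IsRoot] at hz
  linear_combination hz

open Polynomial in
theorem isIntegral_padicInt_of_spectralNorm_le_one {p : ℕ} [Fact p.Prime] {F : Type*} [Field F]
    [Algebra ℚ_[p] F] [FiniteDimensional ℚ_[p] F] [Algebra ℤ_[p] F] [IsScalarTower ℤ_[p] ℚ_[p] F]
    {x : F} (hx : spectralNorm ℚ_[p] F x ≤ 1) : IsIntegral ℤ_[p] x := by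
  have hint : IsIntegral ℚ_[p] x := Algebra.IsIntegral.isIntegral x
  have hcoeff := (spectralValue_le_one_iff (minpoly.monic hint)).1 hx
  have hlift : minpoly ℚ_[p] x ∈ lifts (algebraMap ℤ_[p] ℚ_[p]) := by
    rw [lifts_iff_coeff_lifts]
    exact fun n => ⟨⟨_, hcoeff n⟩, rfl⟩
  obtain ⟨P, hP, -, hmonic⟩ := lifts_and_degree_eq_and_monic hlift (minpoly.monic hint)
  refine ⟨P, hmonic, ?_⟩
  rw [← aeval_def, ← aeval_map_algebraMap ℚ_[p], hP, minpoly.aeval]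

/-- The number of square classes of a finite extension of `ℚ_[p]`. -/
theorem index_range_sq_of_padic (p : ℕ) [Fact p.Prime] (F : Type*) [Field F]
    [Algebra ℚ_[p] F] [FiniteDimensional ℚ_[p] F] :
    (powMonoidHom 2 : Fˣ →* Fˣ).range.index =
      4 * Nat.card (ℤ_[p] ⧸ Ideal.span {(2 : ℤ_[p])}) ^ Module.finrank ℚ_[p] F := by
  let _ : Algebra ℤ_[p] F := ((algebraMap ℚ_[p] F).comp (algebraMap ℤ_[p] ℚ_[p])).toAlgebra
  have : IsScalarTower ℤ_[p] ℚ_[p] F := .of_algebraMap_eq fun _ => rfl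
  have : CharZero F := charZero_of_injective_algebraMap (algebraMap ℚ_[p] F).injective
  have : Module.IsTorsionFree ℤ_[p] F := Module.IsTorsionFree.trans_faithfulSMul ℤ_[p] ℚ_[p] F
  let O := integralClosure ℤ_[p] F
  have : IsFractionRing O F := IsIntegralClosure.isFractionRing_of_finite_extension ℤ_[p] ℚ_[p] F O
  have : IsNoetherianRing O := IsIntegralClosure.isNoetherianRing ℤ_[p] ℚ_[p] F O
  have : Module.Finite ℤ_[p] O := IsIntegralClosure.finite ℤ_[p] ℚ_[p] F O
  have : Module.Free ℤ_[p] O := IsIntegralClosure.module_free ℤ_[p] ℚ_[p] F O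
  have hrank : Module.finrank ℤ_[p] O = Module.finrank ℚ_[p] F :=
    IsIntegralClosure.rank ℤ_[p] ℚ_[p] F O
  have : CharZero O := charZero_of_injective_algebraMap
    (FaithfulSMul.algebraMap_injective ℤ_[p] O)
  have : ValuationRing O := by
    rw [ValuationRing.iff_isInteger_or_isInteger O F]
    have hmem : ∀ x : F, spectralNorm ℚ_[p] F x ≤ 1 → IsLocalization.IsInteger O x := fun x hx =>
      ⟨⟨x, isIntegral_padicInt_of_spectralNorm_le_one hx⟩, rfl⟩
    intro x
    refine (le_total (spectralNorm ℚ_[p] F x) 1).imp (hmem x) fun h => hmem _ ?_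
    rw [← spectralMulAlgNorm_def] at h ⊢
    rw [map_inv₀]
    exact inv_le_one_of_one_le₀ h
  have hp0 : (p : ℤ_[p]) ≠ 0 := PadicInt.prime_p.ne_zero
  have hq0 : algebraMap ℤ_[p] O p ≠ 0 := by simpa using (Fact.out : p.Prime).ne_zero
  have hq : ¬IsUnit (algebraMap ℤ_[p] O p) := fun h =>
    PadicInt.prime_p.not_isUnit (isUnit_of_map_unit (algebraMap ℤ_[p] O) _ h)
  have : IsDiscreteValuationRing O := by
    have : IsPrincipalIdealRing O :=
      ((tfae_of_isNoetherianRing_of_isLocalRing_of_isDomain O).out 0 1).2 ‹ValuationRing O›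
    refine { not_a_field' := fun h => hq0 ?_ }
    rwa [← Ideal.mem_bot, ← h, IsLocalRing.mem_maximalIdeal]
  have hmax : IsLocalRing.maximalIdeal ℤ_[p] = Ideal.span {(p : ℤ_[p])} :=
    PadicInt.maximalIdeal_eq_span_p
  have : IsAdicComplete (Ideal.span {(p : ℤ_[p])}) ℤ_[p] := hmax ▸ inferInstance
  have : IsHausdorff (Ideal.span {(p : ℤ_[p])}) O := hmax ▸ inferInstance
  have := PadicInt.finite_quotient_span (mul_ne_zero two_ne_zero hp0)
  have : Finite (O ⧸ Ideal.span {2 * algebraMap ℤ_[p] O p}) := by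
    apply Nat.finite_of_card_ne_zero
    have := card_quotient_span_algebraMap (S := O) (2 * (p : ℤ_[p]))
    rw [map_mul, map_ofNat] at this
    rw [this]
    exact pow_ne_zero _ Nat.card_pos.ne'
  rw [index_range_sq_fractionField (O := O), index_range_sq_units hq hq0 two_ne_zero
    (exists_add_mul_sq_eq hq0), ← hrank, ← card_quotient_span_algebraMap, map_ofNat, ← mul_assoc]
  norm_num

section Quadratic

variable {F K : Type*} [Field F] [Field K] [Algebra F K] [Algebra.IsQuadraticExtension F K]
  [IsGalois F K]

theorem generator_ne_one_of_quadratic {g : Gal(K/F)} (hg : ∀ x, x ∈ Subgroup.zpowers g) :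
    g ≠ 1 := by
  rintro rfl
  have hcard := IsGalois.card_aut_eq_finrank F K
  have : Subsingleton Gal(K/F) := ⟨fun a b => by
    have ha := hg a
    have hb := hg b
    rw [Subgroup.zpowers_one_eq_bot, Subgroup.mem_bot] at ha hb
    rw [ha, hb]⟩
  rw [Nat.card_unique, Algebra.IsQuadraticExtension.finrank_eq_two] at hcard
  omega

theorem algebraMap_norm_of_quadratic {g : Gal(K/F)} (hg : ∀ x, x ∈ Subgroup.zpowers g) (x : K) :
    algebraMap F K (Algebra.norm F x) = x * g x := by
  classical
  have hg1 := generator_ne_one_of_quadratic hg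
  have huniv : (Finset.univ : Finset Gal(K/F)) = {1, g} := by
    symm
    rw [← Finset.card_eq_iff_eq_univ, Finset.card_pair hg1.symm, ← Nat.card_eq_fintype_card,
      IsGalois.card_aut_eq_finrank, Algebra.IsQuadraticExtension.finrank_eq_two]
  rw [Algebra.norm_eq_prod_automorphisms, huniv, Finset.prod_pair hg1.symm, AlgEquiv.one_apply]

theorem generator_apply_apply_of_quadratic {g : Gal(K/F)} (hg : ∀ x, x ∈ Subgroup.zpowers g)
    (x : K) : g (g x) = x := by
  rcases eq_or_ne x 0 with rfl | hx
  · rw [map_zero, map_zero]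
  · have h1 := algebraMap_norm_of_quadratic hg x
    have h2 := congrArg g h1
    rw [AlgEquiv.commutes, map_mul, h1, mul_comm] at h2
    exact (mul_left_cancel₀ (by simpa using hx) h2).symm

/-- Hilbert's Theorem 90 for quadratic extensions in arbitrary universes. -/
theorem exists_eq_mul_of_norm_eq_one_of_quadratic {g : Gal(K/F)}
    (hg : ∀ x, x ∈ Subgroup.zpowers g) {x : K} (hx : Algebra.norm F x = 1) :
    ∃ z : Kˣ, (z : K) = x * g z := by
  have h := algebraMap_norm_of_quadratic hg x
  rw [hx, map_one] at h
  by_cases h1 : 1 + x = 0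
  · obtain ⟨w, hw⟩ : ∃ w, g w ≠ w := by
      by_contra! hall
      exact generator_ne_one_of_quadratic hg (AlgEquiv.ext hall)
    refine ⟨Units.mk0 (w - g w) (sub_ne_zero.2 hw.symm), ?_⟩
    rw [Units.val_mk0, map_sub, generator_apply_apply_of_quadratic hg]
    linear_combination (w - g w) * h1
  · refine ⟨Units.mk0 (1 + x) h1, ?_⟩
    rw [Units.val_mk0, map_add, map_one]
    linear_combination h

theorem mem_range_algebraMap_of_generator {F L : Type*} [Field F] [Field L] [Algebra F L]
    [FiniteDimensional F L] [IsGalois F L] {g : Gal(L/F)} (hg : ∀ x, x ∈ Subgroup.zpowers g)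
    {x : L} (hx : g x = x) : ∃ c, algebraMap F L c = x := by
  rw [← Set.mem_range, IsGalois.mem_range_algebraMap_iff_fixed]
  intro f
  have : Subgroup.zpowers g ≤ MulAction.stabilizer Gal(L/F) x := by
    rw [Subgroup.zpowers_le]
    exact hx
  exact this (hg f)

/-- If the norm of a quadratic extension is surjective, then the square class groups satisfy
`[Fˣ : Fˣ²] ^ 2 ≤ 2 * [Kˣ : Kˣ²]`. -/
theorem index_range_sq_le_of_norm_surjective
    (hN : ∀ x : F, x ≠ 0 → ∃ y : K, Algebra.norm F y = x) :
    (powMonoidHom 2 : Fˣ →* Fˣ).range.index ^ 2 ≤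
      2 * (powMonoidHom 2 : Kˣ →* Kˣ).range.index := by
  obtain ⟨g, hg⟩ := IsCyclic.exists_generator (α := Gal(K/F))
  set S := (powMonoidHom 2 : Fˣ →* Fˣ).range
  set T := (powMonoidHom 2 : Kˣ →* Kˣ).range
  set ι : Fˣ →* Kˣ := Units.map (algebraMap F K : F →* K)
  set N : Kˣ →* Fˣ := Units.map (Algebra.norm F)
  have hιv : ∀ u, (ι u : K) = algebraMap F K u := fun u => rfl
  have hNv : ∀ u, (N u : F) = Algebra.norm F (u : K) := fun u => rfl
  have hgen : ∀ x : K, algebraMap F K (Algebra.norm F x) = x * g x :=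
    algebraMap_norm_of_quadratic hg
  have hNι : ∀ c, N (ι c) = c ^ 2 := by
    intro c
    ext
    rw [hNv, hιv, Algebra.norm_algebraMap, Algebra.IsQuadraticExtension.finrank_eq_two,
      Units.val_pow_eq_pow_val]
  have hNsurj : Function.Surjective N := by
    intro x
    obtain ⟨y, hy⟩ := hN x x.ne_zero
    have hy0 : y ≠ 0 := by
      rintro rfl
      exact x.ne_zero (by rw [← hy, Algebra.norm_zero])
    exact ⟨Units.mk0 y hy0, Units.ext hy⟩
  have hcomap : S.comap N = T ⊔ ι.range := by
    ext y
    rw [Subgroup.mem_comap]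
    constructor
    · rintro ⟨c, hc⟩
      rw [powMonoidHom_apply] at hc
      have h1 : Algebra.norm F ((y * (ι c)⁻¹ : Kˣ) : K) = 1 := by
        rw [← hNv, map_mul, map_inv, hNι, hc, mul_inv_cancel, Units.val_one]
      obtain ⟨z, hz⟩ := exists_eq_mul_of_norm_eq_one_of_quadratic hg h1
      have hy : y = z ^ 2 * ι (c * (N z)⁻¹) := by
        rw [map_mul, map_inv, ← mul_assoc, eq_mul_inv_iff_mul_eq]
        ext
        have h2 := hgen z
        rw [Units.val_mul] at hz
        have h3 : ((ι c)⁻¹ : Kˣ) * (ι c : K) = 1 := Units.inv_mul _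
        simp only [Units.val_mul, Units.val_pow_eq_pow_val]
        rw [hιv (N z), hNv, h2]
        linear_combination (-(z : K) * (ι c : K)) * hz - y * z * g z * h3
      rw [hy]
      exact Subgroup.mul_mem_sup ⟨z, rfl⟩ ⟨_, rfl⟩
    · intro hy
      obtain ⟨_, ⟨z, rfl⟩, _, ⟨c, rfl⟩, rfl⟩ := Subgroup.mem_sup.1 hy
      exact ⟨N z * c, by simp only [powMonoidHom_apply, map_mul, map_pow, hNι]⟩
  have hST : S ≤ T.comap ι := by
    rintro _ ⟨c, rfl⟩
    exact ⟨ι c, by simp only [powMonoidHom_apply, map_pow]⟩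
  have hroot : ∀ c ∈ T.comap ι, c ∉ S → ∃ z : Kˣ, z ^ 2 = ι c ∧ g z = -z := by
    rintro c ⟨z, hz⟩ hc
    rw [powMonoidHom_apply] at hz
    have hz' : (z : K) ^ 2 = algebraMap F K c := by
      rw [← hιv, ← hz, Units.val_pow_eq_pow_val]
    refine ⟨z, hz, ?_⟩
    have : g z ^ 2 = (z : K) ^ 2 := by rw [← map_pow, hz', AlgEquiv.commutes]
    refine (sq_eq_sq_iff_eq_or_eq_neg.1 this).resolve_left fun h => hc ?_
    obtain ⟨d, hd⟩ := mem_range_algebraMap_of_generator hg h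
    have hdc : d ^ 2 = c := by
      apply (algebraMap F K).injective
      rw [map_pow, hd, hz']
    have hd0 : d ≠ 0 := by
      rintro rfl
      exact c.ne_zero (by rw [← hdc, zero_pow two_ne_zero])
    exact ⟨Units.mk0 d hd0, Units.ext hdc⟩
  have hmul : ∀ b ∈ T.comap ι, ∀ a ∈ T.comap ι, b ∉ S → a ∉ S → b * a ∈ S := by
    intro b hb a ha hbS haS
    obtain ⟨z, hz, hgz⟩ := hroot b hb hbS
    obtain ⟨w, hw, hgw⟩ := hroot a ha haS
    by_contra hS
    obtain ⟨d, hd⟩ := mem_range_algebraMap_of_generator hg (x := (z * w : K))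
      (by rw [map_mul, hgz, hgw, neg_mul_neg])
    have hd0 : d ≠ 0 := by
      rintro rfl
      rw [map_zero] at hd
      exact mul_ne_zero z.ne_zero w.ne_zero hd.symm
    refine hS ⟨Units.mk0 d hd0, Units.ext ((algebraMap F K).injective ?_)⟩
    have : z ^ 2 * w ^ 2 = ι (b * a) := by rw [map_mul, hz, hw]
    rw [← hιv (b * a), ← this]
    simp [hd, mul_pow]
  have hrel : S.relIndex (T.comap ι) ≤ 2 := by
    by_cases h : T.comap ι ≤ S
    · rw [Subgroup.relIndex_eq_one.2 h]
      exact one_le_two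
    · obtain ⟨a, ha, haS⟩ := SetLike.not_le_iff_exists.1 h
      refine (Subgroup.relIndex_eq_two_iff.2 ⟨a, ha, fun b hb => ?_⟩).le
      by_cases hbS : b ∈ S
      · exact .inr ⟨hbS, fun h => haS ((Subgroup.mul_mem_cancel_left S hbS).1 h)⟩
      · exact .inl ⟨hmul b hb a ha hbS haS, hbS⟩
  have h1 : (T.comap ι).index * S.index = T.index := by
    rw [← Subgroup.index_comap_of_surjective S hNsurj, hcomap, Subgroup.index_comap,
      ← Subgroup.relIndex_sup_left, Subgroup.relIndex_mul_index le_sup_left]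
  have h2 : S.index ≤ 2 * (T.comap ι).index := by
    rw [← Subgroup.relIndex_mul_index hST]
    exact Nat.mul_le_mul_right _ hrel
  calc S.index ^ 2 = S.index * S.index := sq _
    _ ≤ 2 * (T.comap ι).index * S.index := Nat.mul_le_mul_right _ h2
    _ = 2 * T.index := by rw [mul_assoc, h1]

end Quadratic

/-- In a cyclic quartic tower `L/K/F`, every element of `F` that is a norm from `L` to `K` is a
norm from `K` to `F`. -/
theorem exists_norm_eq_of_norm_eq_algebraMap {F K L : Type*} [Field F] [Field K] [Field L]
    [Algebra F K] [Algebra K L] [Algebra F L] [IsScalarTower F K L] [IsGalois F L]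
    [Algebra.IsQuadraticExtension F K]
    (hL : Module.finrank F L = 4) (hGal : Nonempty (Gal(L/F) ≃* Multiplicative (ZMod 4)))
    {x : F} (hx : x ≠ 0) {y : L} (hy : Algebra.norm K y = algebraMap F K x) :
    ∃ z : K, Algebra.norm F z = x := by
  obtain ⟨e⟩ := hGal
  have : FiniteDimensional F L := .of_finrank_pos (by omega)
  have : FiniteDimensional K L := .right F K L
  have : IsGalois K L := IsGalois.tower_top_of_isGalois F K L
  have : Algebra.IsQuadraticExtension K L :=
    { finrank_eq_two' := by
        have := Module.finrank_mul_finrank F K L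
        rw [Algebra.IsQuadraticExtension.finrank_eq_two, hL] at this
        omega }
  obtain ⟨τ, hτ⟩ := IsCyclic.exists_generator (α := Gal(L/K))
  have hKL : ∀ a : L, algebraMap K L (Algebra.norm K a) = a * τ a :=
    algebraMap_norm_of_quadratic hτ
  set σ : Gal(L/F) := e.symm (.ofAdd 1)
  have hpow : ∀ n : ℕ, σ ^ n = e.symm (.ofAdd (n : ZMod 4)) := by
    intro n
    rw [← map_pow, ← ofAdd_nsmul, nsmul_one]
  have hσ : ∀ f, f ∈ Subgroup.zpowers σ := by
    intro f
    refine ⟨((e f).toAdd.val : ℤ), ?_⟩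
    simp only [zpow_natCast, hpow, ZMod.natCast_zmod_val, ofAdd_toAdd, e.symm_apply_apply]
  have hσσ : ∀ a, σ (σ a) = τ a := by
    have hτF1 : e (τ.restrictScalars F) ≠ 1 := by
      intro h
      refine generator_ne_one_of_quadratic hτ (AlgEquiv.ext fun a => ?_)
      rw [map_eq_one_iff e e.injective] at h
      exact AlgEquiv.congr_fun h a
    have hτF2 : e (τ.restrictScalars F) * e (τ.restrictScalars F) = 1 := by
      rw [← map_mul, map_eq_one_iff e e.injective]
      exact AlgEquiv.ext (generator_apply_apply_of_quadratic hτ)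
    have hdec : ∀ t : ZMod 4, t ≠ 0 → t + t = 0 → t = (2 : ℕ) := by decide
    have hτF : τ.restrictScalars F = σ ^ 2 := by
      rw [hpow, ← hdec (e (τ.restrictScalars F)).toAdd hτF1 hτF2, ofAdd_toAdd, e.symm_apply_apply]
    intro a
    have := AlgEquiv.congr_fun hτF a
    rw [sq] at this
    exact this.symm
  have hFL : ∀ a : L, algebraMap F L (Algebra.norm F a) = a * σ a * τ a * σ (τ a) := by
    intro a
    rw [Algebra.norm_eq_prod_automorphisms,
      ← ((Multiplicative.ofAdd (α := ZMod 4)).trans e.symm.toEquiv).prod_comp]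
    refine (Fin.prod_univ_four _).trans ?_
    have h0 := AlgEquiv.congr_fun (hpow 0) a
    have h1 := AlgEquiv.congr_fun (hpow 1) a
    have h2 := AlgEquiv.congr_fun (hpow 2) a
    have h3 := AlgEquiv.congr_fun (hpow 3) a
    rw [← hσσ a]
    exact (congrArg₂ _ (congrArg₂ _ (congrArg₂ _ h0 h1) h2) h3).symm
  have hτy : y * τ y = algebraMap F L x := by
    rw [← hKL, hy, ← IsScalarTower.algebraMap_apply]
  have hx0 : algebraMap F L x ≠ 0 := by simpa using hx
  have hy0 : y ≠ 0 := left_ne_zero_of_mul (hτy ▸ hx0)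
  have h1 : Algebra.norm K (σ y / y) = 1 := by
    apply (algebraMap K L).injective
    have h2 : σ y * τ (σ y) = algebraMap F L x := by
      rw [← hσσ (σ y), hσσ y, ← map_mul, hτy, AlgEquiv.commutes]
    rw [hKL, map_one, map_div₀, div_mul_div_comm, h2, hτy, div_self hx0]
  obtain ⟨w, hw⟩ := exists_eq_mul_of_norm_eq_one_of_quadratic hτ h1
  rw [div_mul_eq_mul_div, eq_div_iff hy0] at hw
  obtain ⟨c, hc⟩ := mem_range_algebraMap_of_generator hσ (x := y * (w * σ w)) (by
    rw [map_mul, map_mul, hσσ]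
    linear_combination (-σ w) * hw)
  refine ⟨algebraMap F K c * Algebra.norm K ((w : L)⁻¹), (algebraMap F L).injective ?_⟩
  rw [map_mul, Algebra.norm_norm, Algebra.norm_algebraMap, Algebra.norm_inv,
    Algebra.IsQuadraticExtension.finrank_eq_two, map_mul, map_inv₀, map_pow, hc, hFL, ← hτy,
    ← div_eq_mul_inv]
  have hcc : y * (w * σ w) = τ y * (τ w * σ (τ w)) := by
    have h3 : τ (y * (w * σ w)) = y * (w * σ w) := by
      rw [← hc, ← hσσ, AlgEquiv.commutes, AlgEquiv.commutes]
    rw [← h3, map_mul, map_mul, ← hσσ (σ w), hσσ (w : L)]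
  rw [div_eq_iff (by simp), sq]
  nth_rewrite 2 [hcc]
  ring

/-- If `L/F` is a cyclic quartic extension of a `p`-adic field `F` and `K` is the
quadratic intermediate field, then `F^*` is not contained in `N_{L/K}(L^*)`. -/
theorem stmt_5 (p : ℕ) [Fact p.Prime]
    (F K L : Type*) [Field F] [Field K] [Field L]
    [Algebra ℚ_[p] F] [FiniteDimensional ℚ_[p] F]
    [Algebra F K] [Algebra K L] [Algebra F L] [IsScalarTower F K L]
    [IsGalois F L] (hL : Module.finrank F L = 4)
    (hGal : Nonempty ((L ≃ₐ[F] L) ≃* Multiplicative (ZMod 4)))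
    (hK : Module.finrank F K = 2) :
    ∃ x : F, x ≠ 0 ∧ ∀ y : L, Algebra.norm K y ≠ algebraMap F K x := by
  by_contra! h
  have : CharZero F := charZero_of_injective_algebraMap (algebraMap ℚ_[p] F).injective
  have : Algebra.IsQuadraticExtension F K := { finrank_eq_two' := hK }
  have hle := index_range_sq_le_of_norm_surjective (F := F) (K := K) fun x hx =>
    (h x hx).elim fun _ hy => exists_norm_eq_of_norm_eq_algebraMap hL hGal hx hy
  let _ : Algebra ℚ_[p] K := ((algebraMap F K).comp (algebraMap ℚ_[p] F)).toAlgebra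
  have : IsScalarTower ℚ_[p] F K := .of_algebraMap_eq fun _ => rfl
  have : FiniteDimensional ℚ_[p] K := .trans ℚ_[p] F K
  rw [index_range_sq_of_padic p F, index_range_sq_of_padic p K,
    ← Module.finrank_mul_finrank ℚ_[p] F K, hK, pow_mul] at hle
  have := PadicInt.finite_quotient_span (p := p) two_ne_zero
  have hpos : 0 < Nat.card (ℤ_[p] ⧸ Ideal.span {(2 : ℤ_[p])}) ^ Module.finrank ℚ_[p] F :=
    pow_pos Nat.card_pos _
  nlinarith
end

section
/- Let p be an odd prime and F a finite extension of ℚ_p whose residue field has cardinality q. Suppose there exist fields K and L with F ⊆ K ⊆ L, [K : F] = 2, [L : K] = 2, and L/F not Galois. Then q ≡ 3 (mod 4). -/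
open IsLocalRing Polynomial

theorem IsPrecomplete.of_finite {R : Type*} [CommRing R] (I : Ideal R) [IsPrecomplete I R]
    (M : Type*) [AddCommGroup M] [Module R M] [Module.Finite R M] : IsPrecomplete I M := by
  rw [← AdicCompletion.of_surjective_iff]
  intro x
  obtain ⟨t, rfl⟩ := AdicCompletion.ofTensorProduct_surjective_of_finite I M x
  induction t with
  | zero => exact ⟨0, by simp⟩
  | add a b ha hb =>
    obtain ⟨a', ha⟩ := ha
    obtain ⟨b', hb⟩ := hb
    exact ⟨a' + b', by simp [ha, hb]⟩
  | tmul r m =>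
    obtain ⟨r', rfl⟩ := AdicCompletion.of_surjective I R r
    refine ⟨r' • m, ?_⟩
    rw [AdicCompletion.ofTensorProduct_tmul]
    ext n
    rfl

theorem HenselianRing.isSquare_one_add {R : Type*} [CommRing R] {I : Ideal R} [HenselianRing R I]
    (h2 : IsUnit (2 : R)) {a : R} (ha : a ∈ I) : IsSquare (1 + a) := by
  obtain ⟨r, hr, -⟩ := HenselianRing.is_henselian (I := I) (X ^ 2 - C (1 + a))
    (monic_X_pow_sub_C _ two_ne_zero) 1 (by simpa using ha)
    (by simpa [one_add_one_eq_two] using h2.map (Ideal.Quotient.mk I))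
  refine ⟨r, ?_⟩
  have : r ^ 2 - (1 + a) = 0 := by simpa using hr
  linear_combination -this

/-- Raising to an odd power `p ^ n` moves `1 + m` into `1 + pR`, where Hensel's lemma applies. -/
theorem isSquare_one_add_of_pow_mem {R : Type*} [CommRing R] {p : ℕ} (hp : p.Prime) (hodd : Odd p)
    [HenselianRing R (Ideal.span {(p : R)})] (h2 : IsUnit (2 : R)) {m : R}
    (hu : IsUnit (1 + m)) {N : ℕ} (hN : m ^ N ∈ Ideal.span {(p : R)}) : IsSquare (1 + m) := by
  obtain ⟨r, hr⟩ := exists_add_pow_prime_pow_eq hp 1 m N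
  have hmem : m ^ p ^ N + p * 1 * m * r ∈ Ideal.span {(p : R)} := by
    refine add_mem (Ideal.mem_of_dvd _ (pow_dvd_pow m (Nat.lt_pow_self hp.one_lt).le) hN) ?_
    rw [mul_assoc, mul_assoc]
    exact Ideal.mul_mem_right _ _ (Ideal.mem_span_singleton_self _)
  obtain ⟨y, hy⟩ := HenselianRing.isSquare_one_add h2 hmem
  obtain ⟨k, hk⟩ := hodd.pow (n := N)
  obtain ⟨u, hu⟩ := hu
  rw [one_pow, add_assoc, hy, ← hu] at hr
  rw [← hu]
  refine ⟨y * (↑(u⁻¹ ^ k) : R), ?_⟩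
  have h1 : (u : R) ^ k * ↑(u⁻¹ ^ k) = 1 := by
    rw [← Units.val_pow_eq_pow_val, ← Units.val_mul, ← mul_pow]; simp
  rw [hk] at hr
  linear_combination (↑(u⁻¹ ^ k) : R) ^ 2 * hr - (u : R) * (u ^ k * ↑(u⁻¹ ^ k) + 1) * h1

namespace PadicInt

theorem charZero_of_algebra_padic (p : ℕ) [Fact p.Prime] (F : Type*) [Field F]
    [Algebra ℚ_[p] F] : CharZero F :=
  charZero_of_injective_algebraMap (algebraMap ℚ_[p] F).injective

variable (p : ℕ) [Fact p.Prime] (F : Type*) [Field F] [Algebra ℚ_[p] F]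
  [Algebra ℤ_[p] F] [IsScalarTower ℤ_[p] ℚ_[p] F]

theorem isLocalHom_algebraMap_integralClosure :
    IsLocalHom (algebraMap ℤ_[p] (integralClosure ℤ_[p] F)) := by
  have hinj : Function.Injective (algebraMap ℤ_[p] F) := by
    rw [IsScalarTower.algebraMap_eq ℤ_[p] ℚ_[p] F]
    exact (algebraMap ℚ_[p] F).injective.comp (IsFractionRing.injective ℤ_[p] ℚ_[p])
  have : FaithfulSMul ℤ_[p] F := (faithfulSMul_iff_algebraMap_injective _ _).2 hinj
  infer_instance

theorem natCast_mem_maximalIdeal_integralClosure [IsLocalRing (integralClosure ℤ_[p] F)] :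
    (p : integralClosure ℤ_[p] F) ∈ maximalIdeal (integralClosure ℤ_[p] F) := by
  have := isLocalHom_algebraMap_integralClosure p F
  rw [mem_maximalIdeal, mem_nonunits_iff, ← map_natCast (algebraMap ℤ_[p] _), isUnit_map_iff]
  exact PadicInt.prime_p.not_isUnit

theorem natCast_ne_zero_integralClosure : (p : integralClosure ℤ_[p] F) ≠ 0 := by
  have := charZero_of_algebra_padic p F
  intro h
  have h' : ((p : integralClosure ℤ_[p] F) : F) = 0 := by rw [h]; rfl
  exact (Fact.out : p.Prime).ne_zero (by exact_mod_cast h')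

variable [FiniteDimensional ℚ_[p] F]

theorem module_finite_integralClosure : Module.Finite ℤ_[p] (integralClosure ℤ_[p] F) :=
  have := charZero_of_algebra_padic p F
  IsIntegralClosure.finite ℤ_[p] ℚ_[p] F _

theorem isAdicComplete_integralClosure :
    IsAdicComplete (Ideal.span {(p : integralClosure ℤ_[p] F)}) (integralClosure ℤ_[p] F) := by
  have := module_finite_integralClosure p F
  have := IsPrecomplete.of_finite (maximalIdeal ℤ_[p]) (integralClosure ℤ_[p] F)
  have hmap : (maximalIdeal ℤ_[p]).map (algebraMap ℤ_[p] (integralClosure ℤ_[p] F)) =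
      Ideal.span {(p : integralClosure ℤ_[p] F)} := by
    rw [PadicInt.maximalIdeal_eq_span_p, Ideal.map_span, Set.image_singleton, map_natCast]
  rw [← hmap]
  exact { toIsHausdorff := IsHausdorff.map_algebraMap_iff.2 inferInstance
          toIsPrecomplete := IsPrecomplete.map_algebraMap_iff.2 this }

variable [IsLocalRing (integralClosure ℤ_[p] F)]

theorem finite_residueField_integralClosure :
    Finite (ResidueField (integralClosure ℤ_[p] F)) := by
  have := isLocalHom_algebraMap_integralClosure p F
  have := module_finite_integralClosure p F
  have : Finite (ResidueField ℤ_[p]) := Finite.of_equiv _ PadicInt.residueField.symm.toEquiv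
  exact Module.finite_of_finite (ResidueField ℤ_[p])

theorem isDiscreteValuationRing_integralClosure :
    IsDiscreteValuationRing (integralClosure ℤ_[p] F) := by
  have : IsDedekindDomain (integralClosure ℤ_[p] F) :=
    integralClosure.isDedekindDomain ℤ_[p] ℚ_[p] F
  refine ((IsDiscreteValuationRing.TFAE _ fun hf => ?_).out 0 2).2 this
  obtain ⟨c, hc⟩ := hf.mul_inv_cancel (natCast_ne_zero_integralClosure p F)
  exact (mem_maximalIdeal _).1 (natCast_mem_maximalIdeal_integralClosure p F)
    (.of_mul_eq_one c hc)

theorem isSquare_one_add_integralClosure (hp : Odd p) {m : integralClosure ℤ_[p] F}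
    (hm : m ∈ maximalIdeal (integralClosure ℤ_[p] F)) : IsSquare (1 + m) := by
  have := isAdicComplete_integralClosure p F
  have := isDiscreteValuationRing_integralClosure p F
  have hpm := natCast_mem_maximalIdeal_integralClosure p F
  have h2 : IsUnit (2 : integralClosure ℤ_[p] F) := by
    by_contra h
    obtain ⟨k, hk⟩ := hp
    have : (1 : integralClosure ℤ_[p] F) = p - 2 * k := by
      simp [congrArg (Nat.cast : ℕ → integralClosure ℤ_[p] F) hk]
    exact (Ideal.ne_top_iff_one _).1 (maximalIdeal.isMaximal _).ne_top
      (this ▸ sub_mem hpm (Ideal.mul_mem_right _ _ ((mem_maximalIdeal _).2 h)))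
  have hu : IsUnit (1 + m) := by
    rw [← residue_ne_zero_iff_isUnit, map_add, (residue_eq_zero_iff m).2 hm]
    simp
  obtain ⟨ϖ, hϖ⟩ := IsDiscreteValuationRing.exists_irreducible (integralClosure ℤ_[p] F)
  obtain ⟨N, u, hN⟩ := IsDiscreteValuationRing.eq_unit_mul_pow_irreducible
    (natCast_ne_zero_integralClosure p F) hϖ
  refine isSquare_one_add_of_pow_mem Fact.out hp h2 hu (N := N) ?_
  rw [Ideal.mem_span_singleton, hN, Units.mul_left_dvd]
  rw [hϖ.maximalIdeal_eq, Ideal.mem_span_singleton] at hm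
  exact pow_dvd_pow_of_dvd hm N

end PadicInt

theorem FiniteField.isSquare_mul_of_not_isSquare {k : Type*} [Field k] [Finite k] {a b : k}
    (ha : ¬ IsSquare a) (hb : ¬ IsSquare b) : IsSquare (a * b) := by
  classical
  have := Fintype.ofFinite k
  have hab : a * b ≠ 0 := by
    rintro h
    rcases mul_eq_zero.1 h with rfl | rfl
    exacts [ha IsSquare.zero, hb IsSquare.zero]
  have ha' := quadraticChar_neg_one_iff_not_isSquare.2 ha
  have hb' := quadraticChar_neg_one_iff_not_isSquare.2 hb
  rw [← quadraticChar_one_iff_isSquare hab, map_mul, ha', hb']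
  norm_num

section LocalRing

variable {A : Type*} [CommRing A] [IsLocalRing A]

theorem IsLocalRing.isSquare_of_isSquare_residue
    (hsq : ∀ m ∈ maximalIdeal A, IsSquare (1 + m)) {u : A} (hu : IsUnit u)
    (h : IsSquare (residue A u)) : IsSquare u := by
  obtain ⟨s, hs⟩ := h
  obtain ⟨s, rfl⟩ := residue_surjective s
  have hsu : IsUnit s := by
    rw [← residue_ne_zero_iff_isUnit]
    rintro h0
    rw [h0, mul_zero, residue_eq_zero_iff] at hs
    exact (mem_maximalIdeal _).1 hs hu
  obtain ⟨s, rfl⟩ := hsu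
  have hm : u - s * s ∈ maximalIdeal A := by
    rw [← residue_eq_zero_iff, map_sub, hs, map_mul, sub_self]
  obtain ⟨r, hr⟩ := hsq ((u - s * s) * (↑s⁻¹ * ↑s⁻¹)) (Ideal.mul_mem_right _ _ hm)
  refine ⟨s * r, ?_⟩
  have h1 : (s : A) * ↑s⁻¹ = 1 := s.mul_inv
  calc u = (s * s) * (1 + (u - s * s) * (↑s⁻¹ * ↑s⁻¹)) := by
        linear_combination (-(u - s * s) * (s * ↑s⁻¹ + 1)) * h1
    _ = s * r * (s * r) := by rw [hr]; ring

variable [Finite (ResidueField A)]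

theorem IsLocalRing.isSquare_or_isSquare_mul_of_isUnit
    (hsq : ∀ m ∈ maximalIdeal A, IsSquare (1 + m)) {e z : A} (he : IsUnit e) (hz : IsUnit z)
    (hns : ¬ IsSquare e) : IsSquare z ∨ IsSquare (e * z) := by
  by_cases h : IsSquare (residue A z)
  · exact .inl (isSquare_of_isSquare_residue hsq hz h)
  · refine .inr (isSquare_of_isSquare_residue hsq (he.mul hz) ?_)
    rw [map_mul]
    exact FiniteField.isSquare_mul_of_not_isSquare
      (fun h' => hns (isSquare_of_isSquare_residue hsq he h')) h

theorem IsLocalRing.isSquare_or_isSquare_mul_norm_form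
    (hsq : ∀ m ∈ maximalIdeal A, IsSquare (1 + m)) (hneg : IsSquare (-1 : ResidueField A))
    {e : A} (he : IsUnit e ∧ ¬ IsSquare e ∨ maximalIdeal A = Ideal.span {e}) (t : A) :
    (IsSquare (1 - e * t ^ 2) ∨ IsSquare (e * (1 - e * t ^ 2))) ∧
      (IsSquare (t ^ 2 - e) ∨ IsSquare (e * (t ^ 2 - e))) := by
  rcases he with ⟨he, hns⟩ | hmax
  · have hres : ¬ IsSquare (residue A e) := fun h => hns (isSquare_of_isSquare_residue hsq he h)
    constructor
    · refine isSquare_or_isSquare_mul_of_isUnit hsq he ?_ hns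
      rw [← residue_ne_zero_iff_isUnit]
      intro h0
      rw [map_sub, map_mul, map_pow, map_one, sub_eq_zero] at h0
      have ht : residue A t ≠ 0 := by
        intro ht; simp [ht] at h0
      exact hres ⟨(residue A t)⁻¹, by field_simp; exact h0.symm⟩
    · refine isSquare_or_isSquare_mul_of_isUnit hsq he ?_ hns
      rw [← residue_ne_zero_iff_isUnit]
      intro h0
      rw [map_sub, map_pow, sub_eq_zero] at h0
      exact hres ⟨residue A t, by rw [← h0, sq]⟩
  · have hem : e ∈ maximalIdeal A := hmax ▸ Ideal.mem_span_singleton_self e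
    constructor
    · left
      rw [sub_eq_add_neg]
      exact hsq _ (neg_mem (Ideal.mul_mem_right _ _ hem))
    · by_cases ht : IsUnit t
      · left
        have hr : residue A (t ^ 2 - e) = residue A t * residue A t := by
          rw [map_sub, (residue_eq_zero_iff e).2 hem, sub_zero, map_pow, sq]
        refine isSquare_of_isSquare_residue hsq ?_ ⟨_, hr⟩
        rw [← residue_ne_zero_iff_isUnit, hr]
        have := residue_ne_zero_iff_isUnit t |>.2 ht
        exact mul_ne_zero this this
      · right
        have htm : t ∈ maximalIdeal A := (mem_maximalIdeal t).2 ht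
        obtain ⟨c, rfl⟩ := Ideal.mem_span_singleton'.1 (hmax ▸ htm)
        have h1 : IsSquare (1 + -(c * e * c)) := hsq _ (neg_mem (Ideal.mul_mem_right _ _ htm))
        have h2 : IsSquare (-1 : A) := isSquare_of_isSquare_residue hsq isUnit_one.neg
          (by simpa using hneg)
        have : e * ((c * e) ^ 2 - e) = (e * e) * (-1 * (1 + -(c * e * c))) := by ring
        rw [this]
        exact (IsSquare.mul_self e).mul (h2.mul h1)

end LocalRing

theorem IsDiscreteValuationRing.exists_eq_sq_mul {A F : Type*} [CommRing A] [IsDomain A]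
    [IsDiscreteValuationRing A] [Field F] [Algebra A F] [IsFractionRing A F] {d : F}
    (hd : d ≠ 0) : ∃ (c : F) (e : A), c ≠ 0 ∧ d = c ^ 2 * algebraMap A F e ∧
      (IsUnit e ∨ IsLocalRing.maximalIdeal A = Ideal.span {e}) := by
  obtain ⟨ϖ, hϖ⟩ := IsDiscreteValuationRing.exists_irreducible A
  obtain ⟨a, b, hb, rfl⟩ := IsFractionRing.div_surjective (A := A) d
  have hb0 : algebraMap A F b ≠ 0 := IsFractionRing.to_map_ne_zero_of_mem_nonZeroDivisors hb
  have ha0 : a ≠ 0 := by rintro rfl; simp at hd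
  have hab : a * b ≠ 0 := mul_ne_zero ha0 (nonZeroDivisors.ne_zero hb)
  obtain ⟨n, u, hn⟩ := IsDiscreteValuationRing.eq_unit_mul_pow_irreducible hab hϖ
  have hϖ0 : algebraMap A F ϖ ≠ 0 := (map_ne_zero_iff _ (IsFractionRing.injective A F)).2 hϖ.ne_zero
  have hab' : algebraMap A F a * algebraMap A F b =
      algebraMap A F u * algebraMap A F ϖ ^ n := by rw [← map_mul, hn, map_mul, map_pow]
  rcases Nat.even_or_odd' n with ⟨k, rfl | rfl⟩
  · refine ⟨algebraMap A F ϖ ^ k / algebraMap A F b, u, by positivity, ?_, .inl u.isUnit⟩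
    field_simp
    rw [hab']; ring
  · refine ⟨algebraMap A F ϖ ^ k / algebraMap A F b, u * ϖ, by positivity, ?_, .inr ?_⟩
    · rw [map_mul]
      field_simp
      rw [hab']; ring
    · rw [hϖ.maximalIdeal_eq, Ideal.span_singleton_mul_left_unit u.isUnit]

theorem IsDiscreteValuationRing.isSquare_or_isSquare_mul_norm_form {A F : Type*} [CommRing A]
    [IsDomain A] [IsDiscreteValuationRing A] [Finite (ResidueField A)]
    [Field F] [Algebra A F] [IsFractionRing A F]
    (hsq : ∀ m ∈ IsLocalRing.maximalIdeal A, IsSquare (1 + m)) (hneg : IsSquare (-1 : ResidueField A))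
    {d : F} (hd : ¬ IsSquare d) (x y : F) :
    IsSquare (x ^ 2 - d * y ^ 2) ∨ IsSquare (d * (x ^ 2 - d * y ^ 2)) := by
  have hd0 : d ≠ 0 := by rintro rfl; exact hd IsSquare.zero
  obtain ⟨c, e, hc, rfl, he⟩ := exists_eq_sq_mul (A := A) hd0
  have he' : IsUnit e ∧ ¬ IsSquare e ∨ IsLocalRing.maximalIdeal A = Ideal.span {e} :=
    he.imp_left fun h => ⟨h, fun hs => hd ((IsSquare.sq c).mul (hs.map (algebraMap A F)))⟩
  have key (r : F) (w : A) (h : IsSquare w ∨ IsSquare (e * w)) :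
      IsSquare (r ^ 2 * algebraMap A F w) ∨
        IsSquare (c ^ 2 * algebraMap A F e * (r ^ 2 * algebraMap A F w)) := by
    refine h.imp (fun h => (IsSquare.sq r).mul (h.map (algebraMap A F))) fun h => ?_
    have : c ^ 2 * algebraMap A F e * (r ^ 2 * algebraMap A F w) =
        (c * r) ^ 2 * algebraMap A F (e * w) := by rw [map_mul]; ring
    rw [this]
    exact (IsSquare.sq _).mul (h.map (algebraMap A F))
  by_cases hx : x = 0
  · subst hx
    have := key (c * y) _ (IsLocalRing.isSquare_or_isSquare_mul_norm_form hsq hneg he' 0).2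
    have h' : (0 : F) ^ 2 - c ^ 2 * algebraMap A F e * y ^ 2 =
        (c * y) ^ 2 * algebraMap A F (0 ^ 2 - e) := by
      rw [map_sub, map_pow, map_zero]
      ring
    rwa [h']
  rcases ValuationRing.isInteger_or_isInteger A (c * y / x) with ⟨t, ht⟩ | ⟨t, ht⟩
  · have := key x _ (IsLocalRing.isSquare_or_isSquare_mul_norm_form hsq hneg he' t).1
    have h' : x ^ 2 - c ^ 2 * algebraMap A F e * y ^ 2 =
        x ^ 2 * algebraMap A F (1 - e * t ^ 2) := by
      rw [map_sub, map_mul, map_pow, ht, map_one]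
      field_simp
    rwa [h']
  · by_cases hy : y = 0
    · subst hy
      left
      simpa using IsSquare.sq x
    have := key (c * y) _ (IsLocalRing.isSquare_or_isSquare_mul_norm_form hsq hneg he' t).2
    have h' : x ^ 2 - c ^ 2 * algebraMap A F e * y ^ 2 =
        (c * y) ^ 2 * algebraMap A F (t ^ 2 - e) := by
      rw [map_sub, map_pow, ht]
      field_simp
    rwa [h']

theorem exists_sq_generator_of_finrank_eq_two {F K : Type*} [Field F] [Field K] [Algebra F K]
    (h2 : (2 : F) ≠ 0) (hK : Module.finrank F K = 2) :
    ∃ (d : F) (s : K), s ^ 2 = algebraMap F K d ∧ ¬ IsSquare d ∧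
      ∀ z : K, ∃ x y : F, z = algebraMap F K x + algebraMap F K y * s := by
  have hθ : ∃ θ : K, ∀ a : F, algebraMap F K a ≠ θ := by
    by_contra! h
    have hbot : (⊤ : Subalgebra F K) = ⊥ := by
      rw [eq_comm, eq_top_iff]
      exact fun z _ => Algebra.mem_bot.2 (h z)
    have := Subalgebra.bot_eq_top_iff_finrank_eq_one.1 hbot.symm
    omega
  obtain ⟨θ, hθ⟩ := hθ
  have hli : LinearIndependent F ![(1 : K), θ] := by
    rw [LinearIndependent.pair_iff' one_ne_zero]
    intro a ha
    exact hθ a (by rw [← ha, Algebra.smul_def, mul_one])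
  have hspan : ∀ z : K, ∃ x y : F, algebraMap F K x + algebraMap F K y * θ = z := by
    intro z
    have htop := hli.span_eq_top_of_card_eq_finrank (by simp [hK])
    have hz : z ∈ Submodule.span F (Set.range ![(1 : K), θ]) := htop ▸ Submodule.mem_top
    rw [Matrix.range_cons, Matrix.range_cons, Matrix.range_empty, Set.union_empty,
      Set.singleton_union, Submodule.mem_span_pair] at hz
    simpa [Algebra.smul_def] using hz
  obtain ⟨a, b, hab⟩ := hspan (θ ^ 2)
  have h2K : (2 : K) ≠ 0 := by
    rw [← map_ofNat (algebraMap F K)]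
    exact (_root_.map_ne_zero _).2 h2
  refine ⟨a + b ^ 2 / 4, θ - algebraMap F K (b / 2), ?_, ?_, fun z => ?_⟩
  · have h4 : (4 : K) = 2 * 2 := by norm_num
    simp only [map_add, map_div₀, map_pow, map_ofNat, h4]
    field_simp
    linear_combination (-4) * hab
  · rintro ⟨r, hr⟩
    have hsq : (θ - algebraMap F K (b / 2)) ^ 2 = algebraMap F K r ^ 2 := by
      rw [← map_pow, pow_two r, ← hr]
      have h4 : (4 : K) = 2 * 2 := by norm_num
      simp only [map_add, map_div₀, map_pow, map_ofNat, h4]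
      field_simp
      linear_combination (-4) * hab
    rcases sq_eq_sq_iff_eq_or_eq_neg.1 hsq with h | h
    · exact hθ (r + b / 2) (by rw [map_add]; linear_combination -h)
    · exact hθ (-r + b / 2) (by rw [map_add, map_neg]; linear_combination -h)
  · obtain ⟨x, y, rfl⟩ := hspan z
    exact ⟨x + y * (b / 2), y, by rw [map_add, map_mul]; ring⟩

theorem isGalois_of_quadratic_tower {F K L : Type*} [Field F] [CharZero F] [Field K] [Field L]
    [Algebra F K] [Algebra K L] [Algebra F L] [IsScalarTower F K L]
    (hK : Module.finrank F K = 2) (hL : Module.finrank K L = 2)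
    (hnorm : ∀ d : F, ¬ IsSquare d → ∀ x y : F,
      IsSquare (x ^ 2 - d * y ^ 2) ∨ IsSquare (d * (x ^ 2 - d * y ^ 2))) :
    IsGalois F L := by
  have h2K : (2 : K) ≠ 0 := by
    rw [← map_ofNat (algebraMap F K)]
    exact (_root_.map_ne_zero _).2 two_ne_zero
  obtain ⟨d, s, hs, hd, hKspan⟩ := exists_sq_generator_of_finrank_eq_two (two_ne_zero (α := F)) hK
  obtain ⟨α, β, hβ, hα, hLspan⟩ := exists_sq_generator_of_finrank_eq_two h2K hL
  obtain ⟨x, y, rfl⟩ := hKspan α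
  have hβ0 : β ≠ 0 := by
    rintro rfl
    apply hα
    have : algebraMap K L (algebraMap F K x + algebraMap F K y * s) = 0 := by rw [← hβ]; simp
    rw [(map_eq_zero _).1 this]
    exact IsSquare.zero
  set σ : L := algebraMap K L s with hσ
  have hσ2 : σ ^ 2 = algebraMap F L d := by
    rw [hσ, ← map_pow, hs, ← IsScalarTower.algebraMap_apply]
  have hσ0 : σ ≠ 0 := by
    rintro h
    rw [h, zero_pow two_ne_zero, eq_comm, map_eq_zero] at hσ2
    exact hd (hσ2 ▸ IsSquare.zero)
  rw [map_add, map_mul, ← IsScalarTower.algebraMap_apply, ← IsScalarTower.algebraMap_apply,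
    ← hσ] at hβ
  have hn : ∃ n : L, n ^ 2 = algebraMap F L (x ^ 2 - d * y ^ 2) := by
    rcases hnorm d hd x y with ⟨r, hr⟩ | ⟨r, hr⟩
    · exact ⟨algebraMap F L r, by rw [hr, map_mul, sq]⟩
    · refine ⟨algebraMap F L r / σ, ?_⟩
      have hr' := congrArg (algebraMap F L) hr
      rw [map_mul, map_mul, ← hσ2] at hr'
      field_simp
      linear_combination -hr'
  obtain ⟨n, hn⟩ := hn
  rw [map_sub, map_mul, map_pow, map_pow, ← hσ2] at hn
  have hγ : (n / β) ^ 2 = algebraMap F L x - algebraMap F L y * σ := by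
    have : β ^ 2 ≠ 0 := pow_ne_zero _ hβ0
    rw [div_pow, div_eq_iff this, hn, hβ]
    ring
  generalize n / β = γ at hγ
  let f : F[X] := (X ^ 2 - C d) * (X ^ 4 - C (2 * x) * X ^ 2 + C (x ^ 2 - d * y ^ 2))
  have hf : f.map (algebraMap F L) =
      ((X - C σ) * (X - C (-σ))) * (((X - C β) * (X - C (-β))) * ((X - C γ) * (X - C (-γ)))) := by
    have e1 : ((X - C σ) * (X - C (-σ))) = X ^ 2 - C (σ ^ 2) := by simp; ring
    have e2 : ((X - C β) * (X - C (-β))) = X ^ 2 - C (β ^ 2) := by simp; ring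
    have e3 : ((X - C γ) * (X - C (-γ))) = X ^ 2 - C (γ ^ 2) := by simp; ring
    rw [e1, e2, e3, hβ, hγ]
    simp only [f, Polynomial.map_mul, Polynomial.map_sub, Polynomial.map_add, Polynomial.map_pow,
      map_X, map_C, map_sub, map_mul, map_pow, map_add, ← hσ2, map_ofNat,
      Polynomial.map_ofNat]
    ring
  have hf0 : f.map (algebraMap F L) ≠ 0 := by
    rw [hf]
    simp only [ne_eq, mul_eq_zero, X_sub_C_ne_zero, or_self, not_false_eq_true]
  have hsplit : IsSplittingField F L f := by
    refine ⟨?_, ?_⟩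
    · rw [hf]
      exact ((Splits.X_sub_C _).mul (Splits.X_sub_C _)).mul
        (((Splits.X_sub_C _).mul (Splits.X_sub_C _)).mul
          ((Splits.X_sub_C _).mul (Splits.X_sub_C _)))
    · have hmem : ∀ z : L, (f.map (algebraMap F L)).eval z = 0 →
          z ∈ Algebra.adjoin F (f.rootSet L) := fun z hz =>
        Algebra.subset_adjoin (mem_rootSet'.2 ⟨hf0, by rwa [eval_map_algebraMap] at hz⟩)
      have hσm := hmem σ (by rw [hf]; simp)
      have hβm := hmem β (by rw [hf]; simp)
      have hKm : ∀ z : K, algebraMap K L z ∈ Algebra.adjoin F (f.rootSet L) := by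
        intro z
        obtain ⟨a, b, rfl⟩ := hKspan z
        rw [map_add, map_mul, ← IsScalarTower.algebraMap_apply, ← IsScalarTower.algebraMap_apply]
        exact add_mem (Subalgebra.algebraMap_mem _ a)
          (mul_mem (Subalgebra.algebraMap_mem _ b) hσm)
      rw [eq_top_iff]
      rintro z -
      obtain ⟨a, b, rfl⟩ := hLspan z
      exact add_mem (hKm a) (mul_mem (hKm b) hβm)
  have : Normal F L := Normal.of_isSplittingField f
  exact ⟨⟩

/-- If `p` is odd, `F` a `p`-adic field with residue cardinality `q`, and there exists
a tower of quadratic extensions `L/K/F` with `L/F` not Galois, then `q ≡ 3 [4]`. -/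
theorem stmt_9 (p : ℕ) [Fact p.Prime] (hp : Odd p)
    (F : Type*) [Field F] [Algebra ℚ_[p] F] [FiniteDimensional ℚ_[p] F]
    [Algebra ℤ_[p] F] [IsScalarTower ℤ_[p] ℚ_[p] F]
    [IsLocalRing (integralClosure ℤ_[p] F)]
    (q : ℕ) (hq : Nat.card (IsLocalRing.ResidueField (integralClosure ℤ_[p] F)) = q)
    (K L : Type*) [Field K] [Field L]
    [Algebra F K] [Algebra K L] [Algebra F L] [IsScalarTower F K L]
    (hK : Module.finrank F K = 2) (hL : Module.finrank K L = 2)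
    (hnG : ¬ IsGalois F L) :
    q % 4 = 3 := by
  by_contra hne
  have := PadicInt.charZero_of_algebra_padic p F
  have := PadicInt.isDiscreteValuationRing_integralClosure p F
  have := PadicInt.finite_residueField_integralClosure p F
  have := integralClosure.isFractionRing_of_finite_extension (A := ℤ_[p]) ℚ_[p] F
  have hneg : IsSquare (-1 : IsLocalRing.ResidueField (integralClosure ℤ_[p] F)) := by
    have := Fintype.ofFinite (IsLocalRing.ResidueField (integralClosure ℤ_[p] F))
    rw [FiniteField.isSquare_neg_one_iff, ← Nat.card_eq_fintype_card, hq]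
    exact hne
  exact hnG (isGalois_of_quadratic_tower hK hL fun d hd x y =>
    IsDiscreteValuationRing.isSquare_or_isSquare_mul_norm_form (A := integralClosure ℤ_[p] F)
      (fun m hm => PadicInt.isSquare_one_add_integralClosure p F hp hm) hneg hd x y)
end

section
/- Let F be a finite extension of ℚ_p and L a biquadratic extension of F with distinct quadratic intermediate fields K, K', K''. Let μ : K^* → ℂ^* be a group homomorphism and set ω = μ ∘ N_{L/K} : L^* → ℂ^*. Assume N_{K'/F}(K'^*) is a subgroup of index 2 in F^* and let η' : F^* → ℂ^* be a group homomorphism with kernel exactly N_{K'/F}(K'^*). Then ω is trivial on K'^* (i.e., ω(x) = 1 for all x ∈ K'^* ⊆ L^*) if and only if the restriction of μ to F^* is either the trivial character or equal to η'. -/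
/-- Two distinct quadratic subfields of a quartic extension generate it. -/
theorem IntermediateField.sup_eq_top_of_finrank_eq_two {F L : Type*} [Field F] [Field L]
    [Algebra F L] (hL : Module.finrank F L = 4) {A B : IntermediateField F L}
    (hA : Module.finrank F A = 2) (hB : Module.finrank F B = 2) (hAB : A ≠ B) :
    A ⊔ B = ⊤ := by
  have : FiniteDimensional F L := Module.finite_of_finrank_pos (by omega)
  have hdvd : Module.finrank F ↥(A ⊔ B) ∣ 4 :=
    ⟨_, (hL.symm.trans (Module.finrank_mul_finrank F ↥(A ⊔ B) L).symm)⟩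
  have hne : Module.finrank F ↥(A ⊔ B) ≠ 2 := fun h ↦ hAB <|
    (IntermediateField.eq_of_le_of_finrank_eq le_sup_left (hA.trans h.symm)).trans
      (IntermediateField.eq_of_le_of_finrank_eq le_sup_right (hB.trans h.symm)).symm
  have hle : 2 ≤ Module.finrank F ↥(A ⊔ B) :=
    hA ▸ IntermediateField.finrank_le_of_le_right le_sup_left
  have hle' := Nat.le_of_dvd (by norm_num) hdvd
  refine IntermediateField.eq_of_le_of_finrank_eq le_top ?_
  rw [IntermediateField.finrank_top', hL]
  interval_cases h : Module.finrank F ↥(A ⊔ B) <;> omega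

/-- For distinct quadratic subfields `K`, `K'` of a quartic extension `L / F`, the norm `N_{L/K}`
restricts to `N_{K'/F}` on `K'`. -/
theorem Algebra.norm_algebraMap_of_finrank_eq_two {F K K' L : Type*} [Field F] [Field K]
    [Field K'] [Field L] [Algebra F K] [Algebra F K'] [Algebra F L] [Algebra K L] [Algebra K' L]
    [IsScalarTower F K L] [IsScalarTower F K' L] (hL : Module.finrank F L = 4)
    (hK : Module.finrank F K = 2) (hK' : Module.finrank F K' = 2)
    (hne : (IsScalarTower.toAlgHom F K L).fieldRange ≠ (IsScalarTower.toAlgHom F K' L).fieldRange)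
    (x : K') :
    Algebra.norm K (algebraMap K' L x) = algebraMap F K (Algebra.norm F x) := by
  have : FiniteDimensional F L := Module.finite_of_finrank_pos (by omega)
  let e : K ≃ₐ[F] (IsScalarTower.toAlgHom F K L).fieldRange :=
    AlgEquiv.ofInjectiveField (IsScalarTower.toAlgHom F K L)
  let e' : K' ≃ₐ[F] (IsScalarTower.toAlgHom F K' L).fieldRange :=
    AlgEquiv.ofInjectiveField (IsScalarTower.toAlgHom F K' L)
  have hA := e.toLinearEquiv.finrank_eq.symm.trans hK
  have hB := e'.toLinearEquiv.finrank_eq.symm.trans hK'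
  have htop := IntermediateField.sup_eq_top_of_finrank_eq_two hL hA hB hne
  have hdisj := IntermediateField.LinearDisjoint.of_finrank_sup
    (by rw [htop, IntermediateField.finrank_top', hA, hB, hL])
  have key := hdisj.norm_algebraMap htop (e' x)
  rw [Algebra.norm_eq_of_algEquiv] at key
  rw [Algebra.norm_eq_of_equiv_equiv e.toRingEquiv (RingEquiv.refl L) (by ext; rfl)]
  apply e.injective
  rw [e.commutes, ← key]
  exact e.apply_symm_apply _

/-- If `η` is a character whose kernel `H` has index two, then a character trivial on `H` is
either trivial or equal to `η`. -/
theorem MonoidHom.eq_one_or_eq_of_index_two {G M : Type*} [CommGroup G] [CommRing M] [IsDomain M]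
    {H : Subgroup G} (hH : H.index = 2) {χ η : G →* Mˣ} (hη : η.ker = H) (hχ : H ≤ χ.ker) :
    (∀ x, χ x = 1) ∨ ∀ x, χ x = η x := by
  subst hη
  have hsq {ψ : G →* Mˣ} (hψ : η.ker ≤ ψ.ker) (x : G) : ψ x = 1 ∨ ψ x = -1 := by
    have h := hψ (Subgroup.mul_self_mem_of_index_two hH x)
    rw [MonoidHom.mem_ker, map_mul] at h
    exact (Units.inv_eq_self_iff _).mp (inv_eq_of_mul_eq_one_right h)
  refine or_iff_not_imp_left.mpr fun h x ↦ ?_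
  obtain ⟨a, ha⟩ := not_forall.mp h
  have haη : a ∉ η.ker := fun h ↦ ha (hχ h)
  by_cases hx : x ∈ η.ker
  · rw [MonoidHom.mem_ker.mp hx, MonoidHom.mem_ker.mp (hχ hx)]
  · have hax := hχ ((Subgroup.mul_mem_iff_of_index_two hH).mpr (iff_of_false haη hx))
    rw [MonoidHom.mem_ker, map_mul, (hsq hχ a).resolve_left ha, neg_one_mul] at hax
    rw [(hsq le_rfl x).resolve_left hx, ← hax, neg_neg]

/-- For `L/F` biquadratic with quadratic intermediate fields `K, K', K''`, and
`ω = μ ∘ N_{L/K}`, the character `ω` is trivial on `K'^*` iff `μ` restricted to `F^*`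
is trivial or equal to `η' = η_{K'/F}`. -/
theorem stmt_11 (p : ℕ) [Fact p.Prime]
    (F K K' K'' L : Type*) [Field F] [Field K] [Field K'] [Field K''] [Field L]
    [Algebra ℚ_[p] F] [FiniteDimensional ℚ_[p] F]
    [Algebra F K] [Algebra F K'] [Algebra F K''] [Algebra F L]
    [Algebra K L] [Algebra K' L] [Algebra K'' L]
    [IsScalarTower F K L] [IsScalarTower F K' L] [IsScalarTower F K'' L]
    [IsGalois F L] (hL : Module.finrank F L = 4)
    (hGal : Nonempty ((L ≃ₐ[F] L) ≃* Multiplicative (ZMod 2 × ZMod 2)))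
    (hK : Module.finrank F K = 2) (hK' : Module.finrank F K' = 2)
    (hK'' : Module.finrank F K'' = 2)
    (hd1 : (IsScalarTower.toAlgHom F K L).fieldRange ≠
      (IsScalarTower.toAlgHom F K' L).fieldRange)
    (hd2 : (IsScalarTower.toAlgHom F K L).fieldRange ≠
      (IsScalarTower.toAlgHom F K'' L).fieldRange)
    (hd3 : (IsScalarTower.toAlgHom F K' L).fieldRange ≠
      (IsScalarTower.toAlgHom F K'' L).fieldRange)
    (μ : Kˣ →* ℂˣ)
    (hidx : ((Units.map (Algebra.norm F : K' →* F)).range : Subgroup Fˣ).index = 2)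
    (η' : Fˣ →* ℂˣ)
    (hη' : η'.ker = (Units.map (Algebra.norm F : K' →* F)).range) :
    (∀ x : K'ˣ,
        μ (Units.map (Algebra.norm K : L →* K)
          (Units.map (algebraMap K' L : K' →* L) x)) = 1) ↔
    ((∀ x : Fˣ, μ (Units.map (algebraMap F K : F →* K) x) = 1) ∨
     (∀ x : Fˣ, μ (Units.map (algebraMap F K : F →* K) x) = η' x)) := by
  have hnorm (x : K'ˣ) : Units.map (Algebra.norm K : L →* K)
      (Units.map (algebraMap K' L : K' →* L) x) =
      Units.map (algebraMap F K : F →* K) (Units.map (Algebra.norm F : K' →* F) x) :=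
    Units.ext (Algebra.norm_algebraMap_of_finrank_eq_two hL hK hK' hd1 x)
  simp only [hnorm]
  refine ⟨fun h ↦ ?_, fun h x ↦ ?_⟩
  · refine MonoidHom.eq_one_or_eq_of_index_two hidx
      (χ := μ.comp (Units.map (algebraMap F K : F →* K))) hη' ?_
    rintro _ ⟨x, rfl⟩
    exact h x
  · rcases h with h | h
    · exact h _
    · rw [h, ← MonoidHom.mem_ker, hη']
      exact ⟨x, rfl⟩
end

section
/- Let F be a finite extension of ℚ_p and L a biquadratic extension of F with distinct quadratic intermediate fields K, K', K''. Let η_{K/F} : F^* → ℂ^* be a group homomorphism with kernel exactly N_{K/F}(K^*), and assume N_{K'/F}(K'^*) ≠ N_{K/F}(K^*). Then the homomorphism η_{K/F} ∘ N_{K'/F} : K'^* → ℂ^* is trivial on N_{L/K'}(L^*) but is not the trivial character of K'^*. -/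
open scoped Topology

theorem Subgroup.index_eq_relIndex_map_mul_relIndex_ker {A A' : Type*} [CommGroup A] [Group A']
    (f : A →* A') (B : Subgroup A) :
    B.index = (B.map f).relIndex f.range * B.relIndex f.ker := by
  rw [MonoidHom.range_eq_map, Subgroup.relIndex_map_map, top_sup_eq, Subgroup.relIndex_top_right,
    ← Subgroup.relIndex_mul_index (le_sup_left : B ≤ B ⊔ f.ker), Subgroup.relIndex_sup_left,
    mul_comm]

/-- Invariance of the Herbrand quotient under passage to a subgroup of finite index. -/
theorem Subgroup.herbrand_mul_eq {A : Type*} [CommGroup A] (N D : A →* A) (B : Subgroup A)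
    (hB : B.index ≠ 0) (hND : N.range ≤ D.ker) (hDN : D.range ≤ N.ker)
    (hNB : B.map N ≤ B) (hDB : B.map D ≤ B) :
    N.range.relIndex D.ker * (B.map D).relIndex (B ⊓ N.ker) =
      D.range.relIndex N.ker * (B.map N).relIndex (B ⊓ D.ker) := by
  have hNB' : B.map N ≤ N.range := Subgroup.map_le_range N B
  have hDB' : B.map D ≤ D.range := Subgroup.map_le_range D B
  have e1 := Subgroup.relIndex_mul_relIndex _ _ _ hNB' hND
  have e2 := Subgroup.relIndex_mul_relIndex _ _ _
    (le_inf hNB (hNB'.trans hND)) (inf_le_right : B ⊓ D.ker ≤ D.ker)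
  have e3 := Subgroup.relIndex_mul_relIndex _ _ _ hDB' hDN
  have e4 := Subgroup.relIndex_mul_relIndex _ _ _
    (le_inf hDB (hDB'.trans hDN)) (inf_le_right : B ⊓ N.ker ≤ N.ker)
  rw [Subgroup.inf_relIndex_right] at e2 e4
  have e5 := Subgroup.index_eq_relIndex_map_mul_relIndex_ker N B
  have e6 := Subgroup.index_eq_relIndex_map_mul_relIndex_ker D B
  have key : B.index * (N.range.relIndex D.ker * (B.map D).relIndex (B ⊓ N.ker)) =
      B.index * (D.range.relIndex N.ker * (B.map N).relIndex (B ⊓ D.ker)) := by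
    calc _ = ((B.map N).relIndex N.range * N.range.relIndex D.ker) *
          ((B.map D).relIndex (B ⊓ N.ker) * B.relIndex N.ker) := by rw [e5]; ring
      _ = ((B.map N).relIndex (B ⊓ D.ker) * B.relIndex D.ker) *
          ((B.map D).relIndex D.range * D.range.relIndex N.ker) := by rw [e1, e4, e2, e3]
      _ = _ := by rw [e6]; ring
  exact Nat.eq_of_mul_eq_mul_left (Nat.pos_of_ne_zero hB) key

theorem norm_mul_mul_le {F : Type*} [NormedField F] {r : ℝ} (hr0 : 0 ≤ r) {n x y : F}
    (hn : r * ‖n‖ ≤ 1 / 2) (hx : ‖x‖ ≤ r) (hy : ‖y‖ ≤ r) : ‖n * x * y‖ ≤ r := by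
  rw [norm_mul, norm_mul]
  calc ‖n‖ * ‖x‖ * ‖y‖ ≤ ‖n‖ * r * r := by gcongr
    _ = (r * ‖n‖) * r := by ring
    _ ≤ 1 * r := by gcongr; linarith
    _ = r := one_mul r

section Ultrametric

variable {F : Type*} [NormedField F] [IsUltrametricDist F]

theorem norm_eq_one_of_norm_sub_one_lt {u : F} (hu : ‖u - 1‖ < 1) : ‖u‖ = 1 := by
  have := IsUltrametricDist.norm_add_eq_max_of_norm_ne_norm (x := u - 1) (y := 1)
    (by rw [norm_one]; exact hu.ne)
  rw [sub_add_cancel, norm_one, max_eq_right hu.le] at this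
  exact this

theorem ultrametric_norm_add_le {r : ℝ} {x y : F} (hx : ‖x‖ ≤ r) (hy : ‖y‖ ≤ r) : ‖x + y‖ ≤ r :=
  (IsUltrametricDist.norm_add_le_max x y).trans (max_le hx hy)

theorem ultrametric_norm_sub_le {r : ℝ} {x y : F} (hx : ‖x‖ ≤ r) (hy : ‖y‖ ≤ r) : ‖x - y‖ ≤ r := by
  rw [sub_eq_add_neg]; exact ultrametric_norm_add_le hx (by rwa [norm_neg])

theorem norm_mul_sub_one_le {r : ℝ} (hr : r < 1) {u v : F} (hu : ‖u - 1‖ ≤ r) (hv : ‖v - 1‖ ≤ r) :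
    ‖u * v - 1‖ ≤ r := by
  have : u * v - 1 = u * (v - 1) + (u - 1) := by ring
  rw [this]
  refine ultrametric_norm_add_le ?_ hu
  rwa [norm_mul, norm_eq_one_of_norm_sub_one_lt (hu.trans_lt hr), one_mul]

theorem norm_div_sub_one_le {r : ℝ} (hr : r < 1) {u v : F} (hu : ‖u - 1‖ ≤ r) (hv : ‖v - 1‖ ≤ r) :
    ‖u / v - 1‖ ≤ r := by
  have hv1 : ‖v‖ = 1 := norm_eq_one_of_norm_sub_one_lt (hv.trans_lt hr)
  have hv0 : v ≠ 0 := norm_ne_zero_iff.mp (by rw [hv1]; exact one_ne_zero)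
  have : u / v - 1 = ((u - 1) - (v - 1)) / v := by field_simp; ring
  rw [this, norm_div, hv1, div_one]
  exact ultrametric_norm_sub_le hu hv

/-- The quadratic equation `z + n z² = c` is solvable for small `c`. -/
theorem exists_add_mul_sq_eq_s14 [CompleteSpace F] {r : ℝ} {n c : F} (hn : r * ‖n‖ ≤ 1 / 2)
    (hc : ‖c‖ ≤ r) : ∃ z : F, ‖z‖ ≤ r ∧ z + n * z ^ 2 = c := by
  have hr0 : 0 ≤ r := (norm_nonneg c).trans hc
  let f : F → F := fun z ↦ c - n * z ^ 2
  have hmaps : Set.MapsTo f (Metric.closedBall 0 r) (Metric.closedBall 0 r) := by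
    intro z hz
    rw [mem_closedBall_zero_iff] at hz ⊢
    refine ultrametric_norm_sub_le hc ?_
    rw [pow_two, ← mul_assoc]
    exact norm_mul_mul_le hr0 hn hz hz
  have hcontr : ContractingWith (1 / 2) (hmaps.restrict f _ _) := by
    refine ⟨by rw [← NNReal.coe_lt_coe]; norm_num, LipschitzWith.of_dist_le_mul ?_⟩
    rintro ⟨x, hx⟩ ⟨y, hy⟩
    rw [mem_closedBall_zero_iff] at hx hy
    simp only [Subtype.dist_eq, Set.MapsTo.val_restrict_apply, dist_eq_norm, f]
    have : c - n * x ^ 2 - (c - n * y ^ 2) = -(n * (x + y) * (x - y)) := by ring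
    rw [this, norm_neg, norm_mul, norm_mul]
    have hxy := ultrametric_norm_add_le hx hy
    have : ‖n‖ * ‖x + y‖ ≤ 1 / 2 := by
      calc ‖n‖ * ‖x + y‖ ≤ ‖n‖ * r := by gcongr
        _ ≤ 1 / 2 := by linarith
    push_cast
    gcongr
  obtain ⟨z, hz, hfix, -⟩ := hcontr.exists_fixedPoint' Metric.isClosed_closedBall.isComplete hmaps
    (x := 0) (by simpa using hr0) (edist_ne_top _ _)
  refine ⟨z, by simpa using hz, ?_⟩
  have : c - n * z ^ 2 = z := hfix
  linear_combination -this

end Ultrametric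

theorem mul_conj_eq_norm_form {F K : Type*} [Field F] [Field K] [Algebra F K] {θ θ' : K}
    (hθ : θ + θ' = 1) {n : F} (hn : θ * θ' = algebraMap F K n) (u v : F) :
    (algebraMap F K u * θ + algebraMap F K v * θ') *
      (algebraMap F K v * θ + algebraMap F K u * θ') =
        algebraMap F K (u * v + n * (u - v) * (u - v)) := by
  simp only [map_add, map_mul, map_sub, ← hn]
  linear_combination (algebraMap F K u * algebraMap F K v) * (θ + θ' + 1) * hθ

section LatticeUnits

variable {F K : Type*} [NormedField F] [IsUltrametricDist F] [Field K] [Algebra F K]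

theorem ultrametric_norm_sub_le_of_sub_one {r : ℝ} {u v : F} (hu : ‖u - 1‖ ≤ r)
    (hv : ‖v - 1‖ ≤ r) : ‖u - v‖ ≤ r := by
  simpa only [sub_sub_sub_cancel_right] using ultrametric_norm_sub_le hu hv

theorem norm_norm_form_sub_one_le {r : ℝ} (hr0 : 0 ≤ r) (hr1 : r < 1) {n u v : F}
    (hrn : r * ‖n‖ ≤ 1 / 2) (hu : ‖u - 1‖ ≤ r) (hv : ‖v - 1‖ ≤ r) :
    ‖u * v + n * (u - v) * (u - v) - 1‖ ≤ r := by
  have huv := ultrametric_norm_sub_le_of_sub_one hu hv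
  rw [add_sub_right_comm]
  exact ultrametric_norm_add_le (norm_mul_sub_one_le hr1 hu hv) (norm_mul_mul_le hr0 hrn huv huv)

/-- For conjugate elements `θ, θ'` of trace one, the elements `u θ + v θ'` with `u, v` close to `1`
form a group. -/
theorem exists_subgroup_units_lattice {θ θ' : K} (hθ : θ + θ' = 1)
    {n : F} (hn : θ * θ' = algebraMap F K n)
    {r : ℝ} (hr0 : 0 ≤ r) (hr1 : r < 1) (hrn : r * ‖n‖ ≤ 1 / 2) :
    ∃ W : Subgroup Kˣ, ∀ x : Kˣ, x ∈ W ↔ ∃ u v : F, ‖u - 1‖ ≤ r ∧ ‖v - 1‖ ≤ r ∧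
      (x : K) = algebraMap F K u * θ + algebraMap F K v * θ' := by
  refine ⟨{ carrier := {x | ∃ u v : F, ‖u - 1‖ ≤ r ∧ ‖v - 1‖ ≤ r ∧
      (x : K) = algebraMap F K u * θ + algebraMap F K v * θ'}
            mul_mem' := ?_, one_mem' := ?_, inv_mem' := ?_ }, fun x ↦ Iff.rfl⟩
  · rintro x y ⟨u, v, hu, hv, hx⟩ ⟨u', v', hu', hv', hy⟩
    have hd := norm_mul_mul_le hr0 hrn (ultrametric_norm_sub_le_of_sub_one hu hv)
      (ultrametric_norm_sub_le_of_sub_one hu' hv')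
    refine ⟨u * u' - n * (u - v) * (u' - v'), v * v' - n * (u - v) * (u' - v'), ?_, ?_, ?_⟩
    · rw [sub_right_comm]
      exact ultrametric_norm_sub_le (norm_mul_sub_one_le hr1 hu hu') hd
    · rw [sub_right_comm]
      exact ultrametric_norm_sub_le (norm_mul_sub_one_le hr1 hv hv') hd
    · rw [Units.val_mul, hx, hy]
      simp only [map_mul, map_sub, ← hn]
      have h2 : θ' = 1 - θ := by linear_combination hθ
      rw [h2]; ring
  · exact ⟨1, 1, by simpa using hr0, by simpa using hr0, by simp [hθ]⟩
  · rintro x ⟨u, v, hu, hv, hx⟩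
    have ht := mul_conj_eq_norm_form hθ hn u v
    have ht1 := norm_norm_form_sub_one_le hr0 hr1 hrn hu hv
    set t := u * v + n * (u - v) * (u - v)
    have ht0 : t ≠ 0 := norm_ne_zero_iff.mp (by
      rw [norm_eq_one_of_norm_sub_one_lt (ht1.trans_lt hr1)]; exact one_ne_zero)
    have ht0' : algebraMap F K t ≠ 0 := by simpa using ht0
    refine ⟨v / t, u / t, norm_div_sub_one_le hr1 hv ht1, norm_div_sub_one_le hr1 hu ht1, ?_⟩
    rw [Units.val_inv_eq_inv_val]
    refine inv_eq_of_mul_eq_one_right ?_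
    rw [hx, map_div₀, map_div₀]
    field_simp
    linear_combination ht

end LatticeUnits

section Quadratic

variable {F K : Type*} [NontriviallyNormedField F] [IsUltrametricDist F] [CompleteSpace F]
  [CharZero F] [NormedField K] [NormedAlgebra F K] [FiniteDimensional F K]

/-- An open subgroup of `Kˣ` with trivial Tate cohomology for the involution `σ`. -/
theorem exists_open_cohomologically_trivial (σ : K ≃ₐ[F] K) (hσ : ∀ x, σ (σ x) = x)
    (hfix : ∀ x, σ x = x → ∃ t, algebraMap F K t = x) (hne : ∃ x, σ x ≠ x) :
    ∃ W : Subgroup Kˣ, (W : Set Kˣ) ∈ 𝓝 1 ∧ (∀ x ∈ W, Units.map (σ : K →* K) x ∈ W) ∧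
      (∀ x ∈ W, ∀ t : F, (x : K) * σ x = algebraMap F K t → ‖t‖ = 1) ∧
      (∀ x ∈ W, σ x = x → ∃ w ∈ W, (w : K) * σ w = x) ∧
      (∀ w ∈ W, (w : K) * σ w = 1 → ∃ v ∈ W, (v : K) = w * σ v) := by
  have : CharZero K := charZero_of_injective_algebraMap (algebraMap F K).injective
  obtain ⟨θ, hθ, hθne⟩ : ∃ θ : K, θ + σ θ = 1 ∧ σ θ ≠ θ := by
    obtain ⟨x, hx⟩ := hne
    refine ⟨1 / 2 + (x - σ x), ?_, ?_⟩
    · simp only [map_add, map_sub, hσ, map_div₀, map_one, map_ofNat]; ring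
    · simp only [map_add, map_sub, hσ, map_div₀, map_one, map_ofNat]
      intro h
      exact hx (by linear_combination h / 2)
  obtain ⟨n, hn⟩ := hfix (θ * σ θ) (by rw [map_mul, hσ, mul_comm])
  have hn1 : (0 : ℝ) < ‖n‖ + 1 := by positivity
  set r : ℝ := 1 / (2 * (‖n‖ + 1)) with hr
  have hr0 : 0 < r := by positivity
  have hr1 : r < 1 := by
    rw [hr, div_lt_one (by positivity)]; nlinarith [norm_nonneg n]
  have hrn : r * ‖n‖ ≤ 1 / 2 := by
    rw [hr, div_mul_eq_mul_div, div_le_div_iff₀ (by positivity) (by positivity)]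
    nlinarith [norm_nonneg n]
  obtain ⟨W, hW⟩ := exists_subgroup_units_lattice hθ hn.symm hr0.le hr1 hrn
  have hconj : ∀ u v : F, σ (algebraMap F K u * θ + algebraMap F K v * σ θ) =
      algebraMap F K v * θ + algebraMap F K u * σ θ := fun u v ↦ by
    simp only [map_add, map_mul, AlgEquiv.commutes, hσ]; ring
  have hdiff : θ - σ θ ≠ 0 := sub_ne_zero.mpr hθne.symm
  refine ⟨W, ?_, ?_, ?_, ?_, ?_⟩
  · have hσc : Continuous σ := σ.toLinearMap.continuous_of_finiteDimensional
    let φ : K → K := fun x ↦ (x * θ - σ x * σ θ) / (θ - σ θ)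
    have hφc : Continuous φ := by fun_prop
    have hφ1 : φ 1 = 1 := by
      simp only [φ, map_one, one_mul]; exact div_self hdiff
    have hφF : ∀ x, ∃ t, algebraMap F K t = φ x := fun x ↦ hfix _ (by
      simp only [φ, map_div₀, map_sub, map_mul, hσ]
      rw [← neg_sub θ (σ θ), div_neg, ← neg_div, neg_sub])
    have hmem : {x : Kˣ | ‖φ x - 1‖ < r ∧ ‖φ (σ x) - 1‖ < r} ∈ 𝓝 (1 : Kˣ) := by
      refine IsOpen.mem_nhds (IsOpen.inter ?_ ?_) ⟨by simpa [hφ1], by simpa [hφ1]⟩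
      · exact isOpen_lt ((hφc.comp Units.continuous_val).sub continuous_const).norm
          continuous_const
      · exact isOpen_lt
          ((hφc.comp (hσc.comp Units.continuous_val)).sub continuous_const).norm continuous_const
    refine Filter.mem_of_superset hmem ?_
    rintro x ⟨h1, h2⟩
    obtain ⟨u, hu⟩ := hφF x
    obtain ⟨v, hv⟩ := hφF (σ x)
    rw [← hu, ← map_one (algebraMap F K), ← map_sub, norm_algebraMap'] at h1
    rw [← hv, ← map_one (algebraMap F K), ← map_sub, norm_algebraMap'] at h2
    refine (hW x).mpr ⟨u, v, h1.le, h2.le, ?_⟩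
    rw [hu, hv]
    simp only [φ, hσ]
    have h2 : σ θ = 1 - θ := by linear_combination hθ
    field_simp
    rw [h2]; ring
  · intro x hx
    obtain ⟨u, v, hu, hv, hx⟩ := (hW x).mp hx
    refine (hW _).mpr ⟨v, u, hv, hu, ?_⟩
    rw [← hconj, ← hx]; rfl
  · intro x hx t ht
    obtain ⟨u, v, hu, hv, hx⟩ := (hW x).mp hx
    rw [hx, hconj, mul_conj_eq_norm_form hθ hn.symm] at ht
    rw [← (algebraMap F K).injective ht]
    exact norm_eq_one_of_norm_sub_one_lt
      ((norm_norm_form_sub_one_le hr0.le hr1 hrn hu hv).trans_lt hr1)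
  · intro x hx hxσ
    obtain ⟨u, v, hu, hv, hx⟩ := (hW x).mp hx
    have huv : u = v := by
      rw [hx, hconj] at hxσ
      have : (algebraMap F K u - algebraMap F K v) * (θ - σ θ) = 0 := by linear_combination -hxσ
      exact (algebraMap F K).injective
        (sub_eq_zero.mp ((mul_eq_zero.mp this).resolve_right hdiff))
    subst huv
    obtain ⟨z, hz, hzc⟩ := exists_add_mul_sq_eq_s14 hrn hu
    have hnf := mul_conj_eq_norm_form hθ hn.symm (1 + z) 1
    rw [show (1 + z) * 1 + n * (1 + z - 1) * (1 + z - 1) = u by linear_combination hzc] at hnf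
    have hu0 : algebraMap F K u ≠ 0 := by
      intro h0
      exact x.ne_zero (by rw [hx, h0]; ring)
    refine ⟨Units.mk0 (algebraMap F K (1 + z) * θ + algebraMap F K 1 * σ θ) ?_, ?_, ?_⟩
    · exact left_ne_zero_of_mul (hnf ▸ hu0)
    · exact (hW _).mpr ⟨1 + z, 1, by simpa using hz, by simpa using hr0.le, rfl⟩
    · rw [Units.val_mk0, hconj, hnf, hx]
      linear_combination -algebraMap F K u * hθ
  · intro w hw hw1
    obtain ⟨u, v, hu, hv, hx⟩ := (hW w).mp hw
    rw [hx, hconj, mul_conj_eq_norm_form hθ hn.symm] at hw1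
    have hnf : u * v + n * (u - v) * (u - v) = 1 :=
      (algebraMap F K).injective (by rw [hw1, map_one])
    have huv := ultrametric_norm_sub_le_of_sub_one hv hu
    set d := 1 + (v - u) * n with hd
    have hd1 : ‖d‖ = 1 := by
      refine norm_eq_one_of_norm_sub_one_lt ?_
      rw [hd, add_sub_cancel_left, norm_mul]
      calc ‖v - u‖ * ‖n‖ ≤ r * ‖n‖ := by gcongr
        _ < 1 := by linarith
    have hd0 : d ≠ 0 := norm_ne_zero_iff.mp (by rw [hd1]; exact one_ne_zero)
    set s := (u - 1) / d with hs
    have hs1 : ‖s‖ ≤ r := by rwa [hs, norm_div, hd1, div_one]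
    have hsd : s * d = u - 1 := div_mul_cancel₀ _ hd0
    have hv' : ‖1 + s - 1‖ ≤ r := by simpa using hs1
    have h11 : ‖(1 : F) - 1‖ ≤ r := by simpa using hr0.le
    have hnf' := mul_conj_eq_norm_form hθ hn.symm (1 + s) 1
    have hne0 := norm_norm_form_sub_one_le hr0.le hr1 hrn hv' h11
    set t := (1 + s) * 1 + n * (1 + s - 1) * (1 + s - 1)
    have ht0 : t ≠ 0 := norm_ne_zero_iff.mp (by
      rw [norm_eq_one_of_norm_sub_one_lt (hne0.trans_lt hr1)]; exact one_ne_zero)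
    have ht0' : algebraMap F K t ≠ 0 := by simpa using ht0
    refine ⟨Units.mk0 (algebraMap F K (1 + s) * θ + algebraMap F K 1 * σ θ) ?_, ?_, ?_⟩
    · exact left_ne_zero_of_mul (hnf' ▸ ht0')
    · exact (hW _).mpr ⟨1 + s, 1, hv', h11, rfl⟩
    · have e1 : 1 + s = u + n * (u - v) * s := by linear_combination hsd
      have e2 : 1 = v * (1 + s) + n * (u - v) * s := by
        refine mul_right_cancel₀ hd0 ?_
        linear_combination -hnf - (v + n * (u - v)) * hsd
      have e1' := congrArg (algebraMap F K) e1
      have e2' := congrArg (algebraMap F K) e2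
      have h2 : σ θ = 1 - θ := by linear_combination hθ
      rw [h2] at hn
      simp only [map_add, map_mul, map_sub, map_one, hn] at e1' e2'
      rw [Units.val_mk0, hconj, hx, h2]
      simp only [map_add, map_one]
      linear_combination θ * e1' + (1 - θ) * e2'

end Quadratic

theorem Subgroup.index_ne_zero_of_mem_nhds_one {K : Type*} [NormedField K] [ProperSpace K]
    {B : Subgroup Kˣ} (hB : (B : Set Kˣ) ∈ 𝓝 1) {π : Kˣ} (hπ : ‖(π : K)‖ < 1) (hπB : π ∈ B) :
    B.index ≠ 0 := by
  have hopen : IsOpen (B : Set Kˣ) := B.isOpen_of_mem_nhds hB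
  have : DiscreteTopology (Kˣ ⧸ B) := QuotientGroup.discreteTopology hopen
  have hπ0 : 0 < ‖(π : K)‖ := norm_pos_iff.mpr π.ne_zero
  let S : Set K := {x | ‖(π : K)‖ ≤ ‖x‖ ∧ ‖x‖ ≤ 1}
  have hS : IsCompact S := by
    refine (isCompact_closedBall (0 : K) 1).of_isClosed_subset ?_ ?_
    · exact (isClosed_le continuous_const continuous_norm).inter
        (isClosed_le continuous_norm continuous_const)
    · intro x hx; simpa using hx.2
  have hS' : IsCompact ((Units.val : Kˣ → K) ⁻¹' S) := by
    rw [Units.isEmbedding_val₀.isInducing.isCompact_iff, Set.image_preimage_eq_of_subset]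
    · exact hS
    · intro x hx
      exact ⟨Units.mk0 x (norm_pos_iff.mp (hπ0.trans_le hx.1)), rfl⟩
  have hfin : ((QuotientGroup.mk : Kˣ → Kˣ ⧸ B) '' ((Units.val : Kˣ → K) ⁻¹' S)).Finite :=
    (hS'.image QuotientGroup.continuous_mk).finite_of_discrete
  have huniv : ((QuotientGroup.mk : Kˣ → Kˣ ⧸ B) '' ((Units.val : Kˣ → K) ⁻¹' S)) =
      Set.univ := by
    refine Set.eq_univ_of_forall fun q ↦ ?_
    induction q using QuotientGroup.induction_on with
    | H x =>
      obtain ⟨k, hk⟩ := exists_mem_Ico_zpow (norm_pos_iff.mpr x.ne_zero)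
        ((one_lt_inv₀ hπ0).mpr hπ)
      refine ⟨x * π ^ (k + 1), ?_, ?_⟩
      · have hc : ‖((x * π ^ (k + 1) : Kˣ) : K)‖ = ‖(x : K)‖ * ‖(π : K)‖ ^ (k + 1) := by
          simp [norm_mul, norm_zpow]
        rw [inv_zpow, inv_zpow] at hk
        refine ⟨?_, ?_⟩
        · rw [hc, zpow_add_one₀ hπ0.ne', ← mul_assoc]
          refine le_mul_of_one_le_left hπ0.le ?_
          exact (inv_le_iff_one_le_mul₀ (zpow_pos hπ0 _)).mp hk.1
        · rw [hc]
          rw [← inv_mul_cancel₀ (zpow_pos hπ0 (k + 1)).ne']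
          exact mul_le_mul_of_nonneg_right hk.2.le (zpow_pos hπ0 _).le
      · refine QuotientGroup.eq.mpr ?_
        rw [mul_inv_rev, mul_assoc, inv_mul_cancel, mul_one]
        exact inv_mem (zpow_mem hπB _)
  rw [huniv] at hfin
  have : Finite (Kˣ ⧸ B) := Set.finite_univ_iff.mp hfin
  exact Subgroup.index_ne_zero_of_finite

section Quadratic

variable {F K : Type*} [NontriviallyNormedField F] [IsUltrametricDist F] [ProperSpace F]
  [CharZero F] [NormedField K] [NormedAlgebra F K] [FiniteDimensional F K]

theorem relIndex_norm_eq_two_of_involution (σ : K ≃ₐ[F] K) (hσ : ∀ x, σ (σ x) = x)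
    (hfix : ∀ x, σ x = x → ∃ t, algebraMap F K t = x) (hne : ∃ x, σ x ≠ x)
    (N D : Kˣ →* Kˣ) (hN : ∀ x, (N x : K) = x * σ x) (hD : ∀ x, (D x : K) = x / σ x) :
    N.range.relIndex D.ker = 2 := by
  obtain ⟨W, hW1, hWσ, hWn, hWN, hWD⟩ := exists_open_cohomologically_trivial σ hσ hfix hne
  have : ProperSpace K := FiniteDimensional.proper F K
  have σ_ne : ∀ x : Kˣ, σ x ≠ 0 := fun x ↦ by simp
  have mem_kerN : ∀ x : Kˣ, x ∈ N.ker ↔ (x : K) * σ x = 1 := fun x ↦ by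
    rw [MonoidHom.mem_ker, Units.ext_iff, hN, Units.val_one]
  have mem_kerD : ∀ x : Kˣ, x ∈ D.ker ↔ σ x = x := fun x ↦ by
    rw [MonoidHom.mem_ker, Units.ext_iff, hD, Units.val_one, div_eq_one_iff_eq (σ_ne x), eq_comm]
  have hND : N.range ≤ D.ker := by
    rintro _ ⟨x, rfl⟩
    rw [mem_kerD, hN, map_mul, hσ, mul_comm]
  have hDN : D.range = N.ker := by
    refine le_antisymm ?_ ?_
    · rintro _ ⟨x, rfl⟩
      rw [mem_kerN, hD, map_div₀, hσ]
      have := σ_ne x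
      field_simp
    · intro x hx
      rw [mem_kerN] at hx
      by_cases h : 1 + (x : K) = 0
      · obtain ⟨y, hy⟩ := hne
        refine ⟨Units.mk0 (y - σ y) (sub_ne_zero.mpr hy.symm), Units.ext ?_⟩
        rw [hD, Units.val_mk0, map_sub, hσ, ← neg_sub, neg_div,
          div_self (sub_ne_zero.mpr hy)]
        linear_combination -h
      · refine ⟨Units.mk0 (1 + (x : K)) h, Units.ext ?_⟩
        have h' : σ (1 + (x : K)) ≠ 0 := σ.map_ne_zero_iff.mpr h
        rw [hD, Units.val_mk0, div_eq_iff h', map_add, map_one]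
        linear_combination -hx
  obtain ⟨c, hc0, hc1⟩ := NormedField.exists_norm_lt_one F
  have hc0' : c ≠ 0 := norm_pos_iff.mp hc0
  let π : Kˣ := Units.mk0 (algebraMap F K c) (by simpa using hc0')
  have hπσ : ∀ k : ℤ, σ ((π ^ k : Kˣ) : K) = (π ^ k : Kˣ) := fun k ↦ by
    simp [π, Units.val_zpow_eq_zpow_val]
  let B : Subgroup Kˣ := Subgroup.zpowers π ⊔ W
  have mem_B : ∀ x, x ∈ B ↔ ∃ k : ℤ, ∃ w ∈ W, x = π ^ k * w := fun x ↦ by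
    simp only [B, Subgroup.mem_sup, Subgroup.mem_zpowers_iff]
    constructor
    · rintro ⟨_, ⟨k, rfl⟩, w, hw, rfl⟩; exact ⟨k, w, hw, rfl⟩
    · rintro ⟨k, w, hw, rfl⟩; exact ⟨_, ⟨k, rfl⟩, w, hw, rfl⟩
  have hWB : W ≤ B := le_sup_right
  have hπB : π ∈ B := le_sup_left (a := Subgroup.zpowers π) (Subgroup.mem_zpowers π)
  have hNπ : ∀ (k : ℤ) (w : Kˣ), N (π ^ k * w) = π ^ (2 * k) * N w := fun k w ↦ by
    have : N (π ^ k) = π ^ (2 * k) := Units.ext (by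
      rw [hN, hπσ, two_mul, zpow_add, Units.val_mul])
    rw [map_mul, this]
  have hDπ : ∀ (k : ℤ) (w : Kˣ), D (π ^ k * w) = D w := fun k w ↦ by
    have : D (π ^ k) = 1 := Units.ext (by rw [hD, hπσ, div_self (Units.ne_zero _), Units.val_one])
    rw [map_mul, this, one_mul]
  have hNW : ∀ w ∈ W, N w ∈ W := fun w hw ↦ by
    have : N w = w * Units.map (σ : K →* K) w := Units.ext (hN w)
    rw [this]; exact mul_mem hw (hWσ w hw)
  have hDW : ∀ w ∈ W, D w ∈ W := fun w hw ↦ by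
    have : D w = w / Units.map (σ : K →* K) w := Units.ext (by
      rw [hD, Units.val_div_eq_div_val]; rfl)
    rw [this]; exact div_mem hw (hWσ w hw)
  have norm_one_of_mem : ∀ w ∈ W, ‖(N w : K)‖ = 1 := fun w hw ↦ by
    obtain ⟨t, ht⟩ := hfix (N w) ((mem_kerD _).mp (hND ⟨w, rfl⟩))
    rw [← ht, norm_algebraMap']
    exact hWn w hw t (by rw [← hN, ht])
  have exponent_eq_zero : ∀ (k : ℤ) (w : Kˣ), w ∈ W → N (π ^ k * w) = 1 → k = 0 := by
    intro k w hw h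
    have h1 : ‖((N (π ^ k * w) : Kˣ) : K)‖ = 1 := by rw [h]; simp
    rw [hNπ, Units.val_mul, norm_mul, norm_one_of_mem w hw, mul_one, Units.val_zpow_eq_zpow_val,
      norm_zpow, Units.val_mk0, norm_algebraMap',
      zpow_eq_one_iff_right₀ hc0.le hc1.ne] at h1
    lia
  have hNB : B.map N ≤ B := by
    rintro _ ⟨x, hx, rfl⟩
    obtain ⟨k, w, hw, rfl⟩ := (mem_B x).mp hx
    rw [hNπ]
    exact mul_mem (zpow_mem hπB _) (hWB (hNW w hw))
  have hDB : B.map D ≤ B := by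
    rintro _ ⟨x, hx, rfl⟩
    obtain ⟨k, w, hw, rfl⟩ := (mem_B x).mp hx
    rw [hDπ]
    exact hWB (hDW w hw)
  have hBi : B.index ≠ 0 := Subgroup.index_ne_zero_of_mem_nhds_one
    (Filter.mem_of_superset hW1 hWB) (π := π) (by simpa [π] using hc1) hπB
  have key := Subgroup.herbrand_mul_eq N D B hBi hND hDN.le hNB hDB
  have hDtriv : (B.map D).relIndex (B ⊓ N.ker) = 1 := by
    rw [Subgroup.relIndex_eq_one]
    rintro x ⟨hxB, hxN⟩
    obtain ⟨k, w, hw, rfl⟩ := (mem_B x).mp hxB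
    obtain rfl := exponent_eq_zero k w hw hxN
    rw [zpow_zero, one_mul] at hxN ⊢
    obtain ⟨v, hv, hvw⟩ := hWD w hw ((mem_kerN w).mp hxN)
    refine ⟨v, hWB hv, Units.ext ?_⟩
    rw [hD, div_eq_iff (σ_ne v)]; exact hvw
  have hNtwo : (B.map N).relIndex (B ⊓ D.ker) = 2 := by
    have hπD : π ∈ D.ker := (mem_kerD π).mpr (by simpa using hπσ 1)
    have even_mem : ∀ (j : ℤ) (w : Kˣ), w ∈ W → σ w = (w : K) → π ^ (2 * j) * w ∈ B.map N := by
      intro j w hw hwσ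
      obtain ⟨y, hy, hyw⟩ := hWN w hw hwσ
      refine ⟨π ^ j * y, mul_mem (zpow_mem hπB _) (hWB hy), ?_⟩
      rw [hNπ, Units.ext (((hN y).trans hyw))]
    rw [Subgroup.relIndex_eq_two_iff_exists_notMem_and]
    refine ⟨π, ⟨hπB, hπD⟩, ?_, ?_⟩
    · rintro ⟨x, hx, hxπ⟩
      obtain ⟨k, w, hw, rfl⟩ := (mem_B x).mp hx
      have h1 : ‖((N (π ^ k * w) : Kˣ) : K)‖ = ‖c‖ ^ (1 : ℤ) := by rw [hxπ]; simp [π]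
      rw [hNπ, Units.val_mul, norm_mul, norm_one_of_mem w hw, mul_one, Units.val_zpow_eq_zpow_val,
        norm_zpow, Units.val_mk0, norm_algebraMap'] at h1
      have := zpow_right_injective₀ hc0 hc1.ne h1
      lia
    · rintro x ⟨hxB, hxD⟩
      obtain ⟨k, w, hw, rfl⟩ := (mem_B x).mp hxB
      have hwσ : σ w = (w : K) := by
        rw [← mem_kerD, MonoidHom.mem_ker, ← hDπ k w]; exact hxD
      obtain ⟨j, hj | hj⟩ := Int.even_or_odd' k
      · right; rw [hj]; exact even_mem j w hw hwσ
      · left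
        rw [mul_right_comm, ← zpow_add_one, show k + 1 = 2 * (j + 1) by lia]
        exact even_mem _ w hw hwσ
  rwa [hDtriv, hNtwo, hDN, Subgroup.relIndex_self, mul_one, one_mul] at key

/-- The norm group of a quadratic extension of local fields of characteristic zero has
index two. -/
theorem index_range_units_norm_eq_two (hK : Module.finrank F K = 2) :
    (Units.map (Algebra.norm F : K →* F)).range.index = 2 := by
  have : Algebra.IsQuadraticExtension F K := ⟨hK⟩
  have hcard : Nat.card (K ≃ₐ[F] K) = 2 := by rw [IsGalois.card_aut_eq_finrank, hK]
  obtain ⟨σ, hσ1, huniv⟩ := (Nat.card_eq_two_iff' (1 : K ≃ₐ[F] K)).mp hcard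
  have hall : ∀ τ : K ≃ₐ[F] K, τ = 1 ∨ τ = σ := fun τ ↦ or_iff_not_imp_left.mpr (huniv τ)
  have hσσ : σ * σ = 1 := (hall (σ * σ)).resolve_right fun h ↦ hσ1 (mul_eq_left.mp h)
  have hσ : ∀ x, σ (σ x) = x := fun x ↦ DFunLike.congr_fun hσσ x
  have hfix : ∀ x, σ x = x → ∃ t, algebraMap F K t = x := fun x hx ↦ by
    refine (IsGalois.mem_range_algebraMap_iff_fixed x).mpr fun τ ↦ ?_
    obtain rfl | rfl := hall τ
    · rfl
    · exact hx
  have hne : ∃ x, σ x ≠ x := by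
    by_contra! h
    exact hσ1 (AlgEquiv.ext h)
  have hnorm : ∀ x : K, algebraMap F K (Algebra.norm F x) = x * σ x := fun x ↦ by
    classical
    rw [Algebra.norm_eq_prod_automorphisms]
    have : (Finset.univ : Finset (K ≃ₐ[F] K)) = {1, σ} := by
      ext τ; simpa using hall τ
    rw [this, Finset.prod_pair hσ1.symm, AlgEquiv.one_apply]
  let j : Fˣ →* Kˣ := Units.map (algebraMap F K : F →* K)
  have hj : Function.Injective j := Units.map_injective (algebraMap F K).injective
  let N : Kˣ →* Kˣ := j.comp (Units.map (Algebra.norm F : K →* F))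
  let D : Kˣ →* Kˣ := MonoidHom.id Kˣ / Units.map (σ : K →* K)
  have hD : ∀ x, (D x : K) = x / σ x := fun x ↦ by
    simp [D, Units.val_div_eq_div_val]
  have key := relIndex_norm_eq_two_of_involution σ hσ hfix hne N D (fun x ↦ hnorm x) hD
  have hker : D.ker = j.range := by
    ext x
    have hx0 : σ x ≠ 0 := by simp
    rw [MonoidHom.mem_ker, Units.ext_iff, hD, Units.val_one, div_eq_one_iff_eq hx0]
    constructor
    · intro h
      obtain ⟨t, ht⟩ := hfix x h.symm
      have ht0 : t ≠ 0 := by rintro rfl; exact x.ne_zero (by rw [← ht, map_zero])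
      exact ⟨Units.mk0 t ht0, Units.ext ht⟩
    · rintro ⟨t, rfl⟩
      simp [j]
  rwa [hker, MonoidHom.range_comp, MonoidHom.range_eq_map j,
    Subgroup.relIndex_map_map_of_injective _ _ hj, Subgroup.relIndex_top_right] at key

end Quadratic

theorem index_range_units_norm_eq_two_of_padic (p : ℕ) [Fact p.Prime] (F K : Type*) [Field F]
    [Field K] [Algebra ℚ_[p] F] [FiniteDimensional ℚ_[p] F] [Algebra F K]
    (hK : Module.finrank F K = 2) :
    (Units.map (Algebra.norm F : K →* F)).range.index = 2 := by
  have : FiniteDimensional F K := Module.finite_of_finrank_eq_succ hK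
  have : CharZero F := charZero_of_injective_algebraMap (algebraMap ℚ_[p] F).injective
  let _ : Algebra ℚ_[p] K := ((algebraMap F K).comp (algebraMap ℚ_[p] F)).toAlgebra
  have : IsScalarTower ℚ_[p] F K := IsScalarTower.of_algebraMap_eq fun _ ↦ rfl
  have : FiniteDimensional ℚ_[p] K := FiniteDimensional.trans ℚ_[p] F K
  let _ : NontriviallyNormedField F := spectralNorm.nontriviallyNormedField ℚ_[p] F
  let _ : NormedAlgebra ℚ_[p] F := spectralNorm.normedAlgebra ℚ_[p] F
  let _ : NormedField K := spectralNorm.normedField ℚ_[p] K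
  let _ : NormedAlgebra F K := spectralNorm.normedAlgebra' ℚ_[p] F K
  have : IsUltrametricDist F := IsUltrametricDist.isUltrametricDist_of_isNonarchimedean_norm
    (isNonarchimedean_spectralNorm (K := ℚ_[p]) (L := F))
  have : ProperSpace F := FiniteDimensional.proper ℚ_[p] F
  exact index_range_units_norm_eq_two hK


/-- For `L/F` biquadratic with quadratic intermediate fields `K, K', K''`, the
character `η_{K/F} ∘ N_{K'/F}` of `K'^*` is trivial on `N_{L/K'}(L^*)` but is not the
trivial character. -/
theorem stmt_14 (p : ℕ) [Fact p.Prime]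
    (F K K' K'' L : Type*) [Field F] [Field K] [Field K'] [Field K''] [Field L]
    [Algebra ℚ_[p] F] [FiniteDimensional ℚ_[p] F]
    [Algebra F K] [Algebra F K'] [Algebra F K''] [Algebra F L]
    [Algebra K L] [Algebra K' L] [Algebra K'' L]
    [IsScalarTower F K L] [IsScalarTower F K' L] [IsScalarTower F K'' L]
    [IsGalois F L] (hL : Module.finrank F L = 4)
    (hGal : Nonempty ((L ≃ₐ[F] L) ≃* Multiplicative (ZMod 2 × ZMod 2)))
    (hK : Module.finrank F K = 2) (hK' : Module.finrank F K' = 2)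
    (hK'' : Module.finrank F K'' = 2)
    (hd1 : (IsScalarTower.toAlgHom F K L).fieldRange ≠
      (IsScalarTower.toAlgHom F K' L).fieldRange)
    (hd2 : (IsScalarTower.toAlgHom F K L).fieldRange ≠
      (IsScalarTower.toAlgHom F K'' L).fieldRange)
    (hd3 : (IsScalarTower.toAlgHom F K' L).fieldRange ≠
      (IsScalarTower.toAlgHom F K'' L).fieldRange)
    (η : Fˣ →* ℂˣ) (hη : η.ker = (Units.map (Algebra.norm F : K →* F)).range)
    (hne : (Units.map (Algebra.norm F : K' →* F)).range ≠
      (Units.map (Algebra.norm F : K →* F)).range) :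
    (∀ y : Lˣ, η (Units.map (Algebra.norm F : K' →* F)
        (Units.map (Algebra.norm K' : L →* K') y)) = 1) ∧
    η.comp (Units.map (Algebra.norm F : K' →* F)) ≠ 1 := by
  have : FiniteDimensional F K := Module.finite_of_finrank_eq_succ hK
  have : FiniteDimensional F K' := Module.finite_of_finrank_eq_succ hK'
  have : FiniteDimensional F L := Module.finite_of_finrank_eq_succ hL
  have : FiniteDimensional K L := FiniteDimensional.right F K L
  have : FiniteDimensional K' L := FiniteDimensional.right F K' L
  refine ⟨fun y ↦ ?_, fun htriv ↦ hne ?_⟩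
  · rw [← MonoidHom.mem_ker, hη]
    refine ⟨Units.map (Algebra.norm K : L →* K) y, Units.ext ?_⟩
    simp only [Units.coe_map]
    exact Algebra.norm_norm.trans Algebra.norm_norm.symm
  · have hle : (Units.map (Algebra.norm F : K' →* F)).range ≤
        (Units.map (Algebra.norm F : K →* F)).range := by
      rintro _ ⟨x, rfl⟩
      rw [← hη]
      exact DFunLike.congr_fun htriv x
    have hindex := Subgroup.relIndex_mul_index hle
    rw [index_range_units_norm_eq_two_of_padic p F K hK,
      index_range_units_norm_eq_two_of_padic p F K' hK'] at hindex
    exact le_antisymm hle (Subgroup.relIndex_eq_one.mp (by lia))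
end
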